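/- arXiv:2207.08791 — 6 statements merged into one kernel-verified Lean document; each statement's English description precedes it below -/
import Mathlib

section
/- Let (X, 𝔉) be a measurable space and let P₀ be a convex set of probability measures on X with the property that whenever ρ ∈ P₀ and σ is a probability measure on X with ε·σ ≤ ρ (as measures) for some ε > 0, then σ ∈ P₀. Let a, b : [0,1] → ℝ be continuous functions with a(0) = b(0) = 0, and let f : P₀ → ℝ satisfy f(λρ + (1−λ)σ) ≥ λ·f(ρ) + (1−λ)·f(σ) − a(λ) and f(λρ + (1−λ)σ) ≤ λ·f(ρ) + (1−λ)·f(σ) + b(λ) for all ρ, σ ∈ P₀ and λ ∈ [0,1]. Then for any distinct ρ, σ ∈ P₀, setting ε = sup_{A ∈ 𝔉} |ρ(A) − σ(A)| (the total variation distance), one has f(ρ) − f(σ) ≤ ε · sup{ f(ϱ) − f(ς) : ϱ, ς probability measures on X with ε·ϱ ≤ ρ and ε·ς ≤ σ } + (1+ε)·( a(ε/(1+ε)) + b(ε/(1+ε)) ), where the supremum is taken in [−∞,+∞] (all measures ϱ, ς appearing in it belong to P₀ by the assumed property, so f is defined on them). -/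
open MeasureTheory

/-- Total variation distance between two (finite) measures:
`TV(μ,ν) = sup_{A measurable} |μ(A) − ν(A)|`. -/
noncomputable def TVm {X : Type*} [MeasurableSpace X] (μ ν : Measure X) : ℝ :=
  ⨆ A : {A : Set X // MeasurableSet A}, |(μ A).toReal - (ν A).toReal|

/-- Finite measures differ by a pair of measures dominated by them, the first of which has
mass `ρ s - σ s` for some measurable set `s`. -/
lemma exists_jordan_pair {X : Type*} [MeasurableSpace X] (ρ σ : Measure X)
    [IsFiniteMeasure ρ] [IsFiniteMeasure σ] :
    ∃ p n : Measure X, p ≤ ρ ∧ n ≤ σ ∧ p + σ = n + ρ ∧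
      ∃ s, MeasurableSet s ∧ p Set.univ + σ s = ρ s := by
  obtain ⟨s, h⟩ := exists_isHahnDecomposition σ ρ
  have hp := Measure.sub_add_cancel_of_le h.le_on
  have hn := Measure.sub_add_cancel_of_le h.ge_on_compl
  refine ⟨ρ.restrict s - σ.restrict s, σ.restrict sᶜ - ρ.restrict sᶜ,
    Measure.sub_le.trans Measure.restrict_le_self,
    Measure.sub_le.trans Measure.restrict_le_self, ?_, s, h.measurableSet, ?_⟩
  · calc
      _ = ρ.restrict s - σ.restrict s + (σ.restrict s + σ.restrict sᶜ) := by
        rw [Measure.restrict_add_restrict_compl h.measurableSet]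
      _ = ρ.restrict s + σ.restrict sᶜ := by rw [← add_assoc, hp]
      _ = σ.restrict sᶜ - ρ.restrict sᶜ + (ρ.restrict sᶜ + ρ.restrict s) := by
        rw [← add_assoc, hn, add_comm]
      _ = _ := by
        rw [add_comm (ρ.restrict sᶜ), Measure.restrict_add_restrict_compl h.measurableSet]
  · simpa using congrArg (fun μ : Measure X => μ Set.univ) hp

/-- The total variation distance is the mass of the positive part of the difference. -/
lemma TVm_eq_of_add_eq_add {X : Type*} [MeasurableSpace X] {ρ σ p n : Measure X}
    [IsFiniteMeasure ρ] [IsFiniteMeasure σ] [IsFiniteMeasure p] [IsFiniteMeasure n]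
    (h : p + σ = n + ρ) (hpn : p Set.univ = n Set.univ) {s : Set X} (hs : MeasurableSet s)
    (hps : p Set.univ + σ s = ρ s) : TVm ρ σ = p.real Set.univ := by
  have hle : ∀ A : {A : Set X // MeasurableSet A},
      |(ρ A).toReal - (σ A).toReal| ≤ p.real Set.univ := by
    intro A
    have hA : p.real A + σ.real A = n.real A + ρ.real A := by
      rw [← measureReal_add_apply, ← measureReal_add_apply, h]
    have hp : p.real A ≤ p.real Set.univ := measureReal_mono (Set.subset_univ _)
    have hn : n.real A ≤ p.real Set.univ := by
      rw [measureReal_def p, hpn]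
      exact measureReal_mono (Set.subset_univ _)
    have hp0 : 0 ≤ p.real A := measureReal_nonneg
    have hn0 : 0 ≤ n.real A := measureReal_nonneg
    change |ρ.real A - σ.real A| ≤ _
    rw [abs_le]
    constructor <;> linarith
  have : Nonempty {A : Set X // MeasurableSet A} := ⟨⟨s, hs⟩⟩
  refine le_antisymm (ciSup_le hle) ?_
  refine le_trans ?_ (le_ciSup ⟨p.real Set.univ, Set.forall_mem_range.2 hle⟩ ⟨s, hs⟩)
  refine le_trans (le_of_eq ?_) (le_abs_self _)
  rw [← hps, ENNReal.toReal_add (measure_ne_top _ _) (measure_ne_top _ _), measureReal_def]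
  ring

/-- A nonzero finite measure is its mass times a probability measure. -/
lemma exists_isProbabilityMeasure_smul_eq {X : Type*} [MeasurableSpace X] {p : Measure X} {ε : ℝ}
    (hε : 0 < ε) (hp : p Set.univ = ENNReal.ofReal ε) :
    ∃ τ : Measure X, IsProbabilityMeasure τ ∧ ENNReal.ofReal ε • τ = p := by
  have h0 : ENNReal.ofReal ε ≠ 0 := by simpa using hε
  refine ⟨(ENNReal.ofReal ε)⁻¹ • p, ⟨?_⟩, ?_⟩
  · rw [Measure.smul_apply, hp, smul_eq_mul, ENNReal.inv_mul_cancel h0 ENNReal.ofReal_ne_top]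
  · rw [smul_smul, ENNReal.mul_inv_cancel h0 ENNReal.ofReal_ne_top, one_smul]

/-- A mixture with weight `ε / (1 + ε)` is a normalized sum. -/
lemma mix_eq_smul_add {X : Type*} [MeasurableSpace X] (τ μ : Measure X) {ε : ℝ} (hε : 0 < ε) :
    ENNReal.ofReal (ε / (1 + ε)) • τ + ENNReal.ofReal (1 - ε / (1 + ε)) • μ =
      ENNReal.ofReal (1 + ε)⁻¹ • (ENNReal.ofReal ε • τ + μ) := by
  have h1 : 1 - ε / (1 + ε) = (1 + ε)⁻¹ := by field_simp; ring
  rw [h1, div_eq_inv_mul, ENNReal.ofReal_mul (by positivity), smul_add, smul_smul]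

/-- **Quasi-classical Alicki–Fannes–Winter basic lemma** (measure-level form).
If `P₀` is a convex set of probability measures closed under taking probability
measures dominated (up to a positive factor) by its elements, and `f` is a locally
almost affine function on `P₀` with perturbation functions `a`, `b`, then for
distinct `ρ, σ ∈ P₀` with `ε = TV(ρ,σ)`:
`f(ρ) − f(σ) ≤ ε · sup{f(ϱ) − f(ς) : ε·ϱ ≤ ρ, ε·ς ≤ σ} + (1+ε)(a+b)(ε/(1+ε))`. -/
theorem quasiClassical_AFW_basic_lemma
    {X : Type*} [MeasurableSpace X] (P₀ : Set (Measure X))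
    (hprob : ∀ μ ∈ P₀, IsProbabilityMeasure μ)
    (hconv : ∀ μ ∈ P₀, ∀ ν ∈ P₀, ∀ t : ℝ, 0 ≤ t → t ≤ 1 →
      (ENNReal.ofReal t • μ + ENNReal.ofReal (1 - t) • ν) ∈ P₀)
    (hup : ∀ μ ∈ P₀, ∀ ν : Measure X, IsProbabilityMeasure ν →
      (∃ e : ℝ, 0 < e ∧ ENNReal.ofReal e • ν ≤ μ) → ν ∈ P₀)
    (a b : ℝ → ℝ)
    (ha : ContinuousOn a (Set.Icc 0 1)) (hb : ContinuousOn b (Set.Icc 0 1))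
    (ha0 : a 0 = 0) (hb0 : b 0 = 0)
    (f : Measure X → ℝ)
    (hlaa1 : ∀ μ ∈ P₀, ∀ ν ∈ P₀, ∀ t : ℝ, 0 ≤ t → t ≤ 1 →
      t * f μ + (1 - t) * f ν - a t ≤
        f (ENNReal.ofReal t • μ + ENNReal.ofReal (1 - t) • ν))
    (hlaa2 : ∀ μ ∈ P₀, ∀ ν ∈ P₀, ∀ t : ℝ, 0 ≤ t → t ≤ 1 →
      f (ENNReal.ofReal t • μ + ENNReal.ofReal (1 - t) • ν) ≤
        t * f μ + (1 - t) * f ν + b t)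
    (ρ σ : Measure X) (hρ : ρ ∈ P₀) (hσ : σ ∈ P₀) (hne : ρ ≠ σ)
    (ε : ℝ) (hε : ε = TVm ρ σ) :
    ((f ρ - f σ : ℝ) : EReal) ≤
      (ε : EReal) * sSup {d : EReal | ∃ ϱ ς : Measure X,
          IsProbabilityMeasure ϱ ∧ IsProbabilityMeasure ς ∧
          ENNReal.ofReal ε • ϱ ≤ ρ ∧ ENNReal.ofReal ε • ς ≤ σ ∧
          d = ((f ϱ - f ς : ℝ) : EReal)}
        + (((1 + ε) * (a (ε / (1 + ε)) + b (ε / (1 + ε))) : ℝ) : EReal) := by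
  have := hprob ρ hρ
  have := hprob σ hσ
  obtain ⟨p, n, hpρ, hnσ, hadd, s, hs, hps⟩ := exists_jordan_pair ρ σ
  have : IsFiniteMeasure p := isFiniteMeasure_of_le ρ hpρ
  have : IsFiniteMeasure n := isFiniteMeasure_of_le σ hnσ
  have hpn : p Set.univ = n Set.univ := by
    have h := congrArg (fun μ : Measure X => μ Set.univ) hadd
    simp only [Measure.add_apply, measure_univ] at h
    exact (ENNReal.add_left_inj ENNReal.one_ne_top).1 h
  have hεp : ε = p.real Set.univ := hε.trans (TVm_eq_of_add_eq_add hadd hpn hs hps)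
  have hpε : p Set.univ = ENNReal.ofReal ε := by rw [hεp, ofReal_measureReal]
  have hε0 : 0 < ε := by
    refine lt_of_le_of_ne (hεp ▸ measureReal_nonneg) fun h0 => hne ?_
    have hp0 : p = 0 := Measure.measure_univ_eq_zero.1 (by rw [hpε, ← h0, ENNReal.ofReal_zero])
    have hn0 : n = 0 := Measure.measure_univ_eq_zero.1 (by rw [← hpn, hp0]; rfl)
    rw [hp0, hn0, zero_add, zero_add] at hadd
    exact hadd.symm
  obtain ⟨τ, hτ, hτp⟩ := exists_isProbabilityMeasure_smul_eq hε0 hpε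
  obtain ⟨υ, hυ, hυn⟩ := exists_isProbabilityMeasure_smul_eq hε0 (hpn ▸ hpε)
  have hτρ : ENNReal.ofReal ε • τ ≤ ρ := hτp ▸ hpρ
  have hυσ : ENNReal.ofReal ε • υ ≤ σ := hυn ▸ hnσ
  have hτP : τ ∈ P₀ := hup ρ hρ τ hτ ⟨ε, hε0, hτρ⟩
  have hυP : υ ∈ P₀ := hup σ hσ υ hυ ⟨ε, hε0, hυσ⟩
  have ht0 : 0 ≤ ε / (1 + ε) := by positivity
  have ht1 : ε / (1 + ε) ≤ 1 := by rw [div_le_one (by positivity)]; linarith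
  have hlow := hlaa1 υ hυP ρ hρ _ ht0 ht1
  have hupp := hlaa2 τ hτP σ hσ _ ht0 ht1
  rw [mix_eq_smul_add _ _ hε0, hυn, ← hadd] at hlow
  rw [mix_eq_smul_add _ _ hε0, hτp] at hupp
  have hmul := mul_le_mul_of_nonneg_left (hlow.trans hupp) (by positivity : 0 ≤ 1 + ε)
  have hreal : f ρ - f σ ≤ ε * (f τ - f υ) +
      (1 + ε) * (a (ε / (1 + ε)) + b (ε / (1 + ε))) := by
    have hc : (1 + ε) * (ε / (1 + ε)) = ε := by field_simp
    linear_combination hmul + (f τ - f υ - f σ + f ρ) * hc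
  refine (EReal.coe_le_coe_iff.2 hreal).trans ?_
  rw [EReal.coe_add, EReal.coe_mul]
  gcongr
  exact le_sSup ⟨τ, υ, hτ, hυ, hτρ, hυσ, rfl⟩
end

section
/- Let (X, 𝔉) be a measurable space and let P₀ be a convex set of probability measures on X with the property that whenever ρ ∈ P₀ and σ is a probability measure on X with ε·σ ≤ ρ (as measures) for some ε > 0, then σ ∈ P₀. Let a, b : [0,1] → ℝ be continuous functions with a(0) = b(0) = 0, and let f : P₀ → ℝ be a nonnegative function satisfying f(λρ + (1−λ)σ) ≥ λ·f(ρ) + (1−λ)·f(σ) − a(λ) and f(λρ + (1−λ)σ) ≤ λ·f(ρ) + (1−λ)·f(σ) + b(λ) for all ρ, σ ∈ P₀ and λ ∈ [0,1]. Then for any distinct ρ, σ ∈ P₀, setting ε = sup_{A ∈ 𝔉} |ρ(A) − σ(A)|, one has f(ρ) − f(σ) ≤ ε · sup{ f(ϱ) : ϱ a probability measure on X with ε·ϱ ≤ ρ } + (1+ε)·( a(ε/(1+ε)) + b(ε/(1+ε)) ), where the supremum is taken in [−∞,+∞]. -/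
open MeasureTheory

/-- The total variation distance of two distinct probability measures is the common mass of the
positive and negative parts of their difference. -/
theorem exists_decomposition_of_TVm {X : Type*} [MeasurableSpace X] (ρ σ : Measure X)
    [IsProbabilityMeasure ρ] [IsProbabilityMeasure σ] (hne : ρ ≠ σ) :
    0 < TVm ρ σ ∧ ∃ p q : Measure X, IsProbabilityMeasure p ∧ IsProbabilityMeasure q ∧
      ENNReal.ofReal (TVm ρ σ) • p ≤ ρ ∧ ENNReal.ofReal (TVm ρ σ) • q ≤ σ ∧
      ρ + ENNReal.ofReal (TVm ρ σ) • q = σ + ENNReal.ofReal (TVm ρ σ) • p := by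
  obtain ⟨s, hs⟩ := exists_isHahnDecomposition ρ σ
  have hsm := hs.measurableSet
  set ν := ρ.restrict s + σ.restrict sᶜ with hν
  have hνρ : ν ≤ ρ := by
    calc ν ≤ ρ.restrict s + ρ.restrict sᶜ := by exact add_le_add le_rfl hs.ge_on_compl
      _ = ρ := Measure.restrict_add_restrict_compl hsm
  have hνσ : ν ≤ σ := by
    calc ν ≤ σ.restrict s + σ.restrict sᶜ := by exact add_le_add hs.le_on le_rfl
      _ = σ := Measure.restrict_add_restrict_compl hsm
  set P := ρ - ν
  set Q := σ - ν
  have hP : P + ν = ρ := Measure.sub_add_cancel_of_le hνρ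
  have hQ : Q + ν = σ := Measure.sub_add_cancel_of_le hνσ
  have hPr (A : Set X) : P.real A + ν.real A = ρ.real A := by
    rw [← measureReal_add_apply, hP]
  have hQr (A : Set X) : Q.real A + ν.real A = σ.real A := by
    rw [← measureReal_add_apply, hQ]
  have hPu := hPr Set.univ
  have hQu := hQr Set.univ
  rw [probReal_univ (μ := ρ)] at hPu
  rw [probReal_univ (μ := σ)] at hQu
  have hbound (A : Set X) : |ρ.real A - σ.real A| ≤ P.real Set.univ := by
    have h1 : P.real A ≤ P.real Set.univ := measureReal_mono (Set.subset_univ A)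
    have h2 : Q.real A ≤ Q.real Set.univ := measureReal_mono (Set.subset_univ A)
    have h3 : 0 ≤ P.real A := measureReal_nonneg
    have h4 : 0 ≤ Q.real A := measureReal_nonneg
    rw [← hPr A, ← hQr A, abs_le]
    constructor <;> linarith
  have hTV : TVm ρ σ = P.real Set.univ := by
    have : Nonempty {A : Set X // MeasurableSet A} := ⟨⟨∅, MeasurableSet.empty⟩⟩
    apply le_antisymm
    · exact ciSup_le fun A => hbound A
    · have hle : |ρ.real sᶜ - σ.real sᶜ| ≤ TVm ρ σ :=
        le_ciSup (f := fun A : {A : Set X // MeasurableSet A} => |ρ.real A - σ.real A|)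
          ⟨P.real Set.univ, by rintro _ ⟨A, rfl⟩; exact hbound A⟩ ⟨sᶜ, hsm.compl⟩
      have hνu : ν.real Set.univ = ρ.real s + σ.real sᶜ := by
        rw [hν, measureReal_add_apply]; simp [measureReal_restrict_apply]
      have hρu : ρ.real s + ρ.real sᶜ = 1 := by
        rw [measureReal_add_measureReal_compl hsm, probReal_univ]
      have := le_abs_self (ρ.real sᶜ - σ.real sᶜ)
      linarith
  have hPT : P Set.univ = ENNReal.ofReal (TVm ρ σ) := by rw [hTV, ofReal_measureReal]
  have hQT : Q Set.univ = ENNReal.ofReal (TVm ρ σ) := by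
    rw [hTV, show P.real Set.univ = Q.real Set.univ by linarith, ofReal_measureReal]
  have hpos : 0 < TVm ρ σ := by
    refine lt_of_le_of_ne (hTV ▸ measureReal_nonneg) fun h => hne ?_
    rw [← h, ENNReal.ofReal_zero, Measure.measure_univ_eq_zero] at hPT hQT
    rw [← hP, ← hQ, hPT, hQT]
  have hc0 : ENNReal.ofReal (TVm ρ σ) ≠ 0 := (ENNReal.ofReal_pos.2 hpos).ne'
  have hcancel (μ : Measure X) :
      ENNReal.ofReal (TVm ρ σ) • (ENNReal.ofReal (TVm ρ σ))⁻¹ • μ = μ := by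
    rw [smul_smul, ENNReal.mul_inv_cancel hc0 ENNReal.ofReal_ne_top, one_smul]
  refine ⟨hpos, (ENNReal.ofReal (TVm ρ σ))⁻¹ • P, (ENNReal.ofReal (TVm ρ σ))⁻¹ • Q,
    ⟨?_⟩, ⟨?_⟩, ?_, ?_, ?_⟩
  · rw [Measure.smul_apply, hPT, smul_eq_mul, ENNReal.inv_mul_cancel hc0 ENNReal.ofReal_ne_top]
  · rw [Measure.smul_apply, hQT, smul_eq_mul, ENNReal.inv_mul_cancel hc0 ENNReal.ofReal_ne_top]
  · rw [hcancel]; exact Measure.sub_le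
  · rw [hcancel]; exact Measure.sub_le
  · rw [hcancel, hcancel]
    calc ρ + Q = P + ν + Q := by rw [hP]
      _ = Q + ν + P := by abel
      _ = σ + P := by rw [hQ]

/-- **Quasi-classical Alicki–Fannes–Winter basic lemma, one-sided variant for
nonnegative functions** (measure-level form). If `P₀` is a convex set of
probability measures closed under taking probability measures dominated (up to a
positive factor) by its elements, and `f` is a nonnegative locally almost affine
function on `P₀` with perturbation functions `a`, `b`, then for distinct
`ρ, σ ∈ P₀` with `ε = TV(ρ,σ)`:
`f(ρ) − f(σ) ≤ ε · sup{f(ϱ) : ε·ϱ ≤ ρ} + (1+ε)(a+b)(ε/(1+ε))`. -/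
theorem quasiClassical_AFW_basic_lemma_oneSide
    {X : Type*} [MeasurableSpace X] (P₀ : Set (Measure X))
    (hprob : ∀ μ ∈ P₀, IsProbabilityMeasure μ)
    (hconv : ∀ μ ∈ P₀, ∀ ν ∈ P₀, ∀ t : ℝ, 0 ≤ t → t ≤ 1 →
      (ENNReal.ofReal t • μ + ENNReal.ofReal (1 - t) • ν) ∈ P₀)
    (hup : ∀ μ ∈ P₀, ∀ ν : Measure X, IsProbabilityMeasure ν →
      (∃ e : ℝ, 0 < e ∧ ENNReal.ofReal e • ν ≤ μ) → ν ∈ P₀)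
    (a b : ℝ → ℝ)
    (ha : ContinuousOn a (Set.Icc 0 1)) (hb : ContinuousOn b (Set.Icc 0 1))
    (ha0 : a 0 = 0) (hb0 : b 0 = 0)
    (f : Measure X → ℝ)
    (hfnn : ∀ μ ∈ P₀, 0 ≤ f μ)
    (hlaa1 : ∀ μ ∈ P₀, ∀ ν ∈ P₀, ∀ t : ℝ, 0 ≤ t → t ≤ 1 →
      t * f μ + (1 - t) * f ν - a t ≤
        f (ENNReal.ofReal t • μ + ENNReal.ofReal (1 - t) • ν))
    (hlaa2 : ∀ μ ∈ P₀, ∀ ν ∈ P₀, ∀ t : ℝ, 0 ≤ t → t ≤ 1 →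
      f (ENNReal.ofReal t • μ + ENNReal.ofReal (1 - t) • ν) ≤
        t * f μ + (1 - t) * f ν + b t)
    (ρ σ : Measure X) (hρ : ρ ∈ P₀) (hσ : σ ∈ P₀) (hne : ρ ≠ σ)
    (ε : ℝ) (hε : ε = TVm ρ σ) :
    ((f ρ - f σ : ℝ) : EReal) ≤
      (ε : EReal) * sSup {d : EReal | ∃ ϱ : Measure X,
          IsProbabilityMeasure ϱ ∧ ENNReal.ofReal ε • ϱ ≤ ρ ∧
          d = ((f ϱ : ℝ) : EReal)}
        + (((1 + ε) * (a (ε / (1 + ε)) + b (ε / (1 + ε))) : ℝ) : EReal) := by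
  have := hprob ρ hρ
  have := hprob σ hσ
  obtain ⟨hpos, p, q, _, _, hp, hq, hpq⟩ := exists_decomposition_of_TVm ρ σ hne
  rw [← hε] at hpos hp hq hpq
  have hpP : p ∈ P₀ := hup ρ hρ p inferInstance ⟨ε, hpos, hp⟩
  have hqP : q ∈ P₀ := hup σ hσ q inferInstance ⟨ε, hpos, hq⟩
  have h1ε : 0 < 1 + ε := by linarith
  set t := ε / (1 + ε) with ht
  have ht0 : 0 ≤ t := by positivity
  have ht1 : t ≤ 1 := by rw [ht, div_le_one h1ε]; linarith
  have hs : 1 - t = (1 + ε)⁻¹ := by rw [ht]; field_simp; ring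
  have hmix : ENNReal.ofReal t • q + ENNReal.ofReal (1 - t) • ρ =
      ENNReal.ofReal t • p + ENNReal.ofReal (1 - t) • σ := by
    have htm : ENNReal.ofReal t = ENNReal.ofReal (1 - t) * ENNReal.ofReal ε := by
      rw [← ENNReal.ofReal_mul (by linarith), hs, ht, div_eq_inv_mul]
    rw [htm, mul_smul, mul_smul, ← smul_add, ← smul_add, add_comm _ ρ, add_comm _ σ, hpq]
  have h1 := hlaa1 q hqP ρ hρ t ht0 ht1
  have h2 := hlaa2 p hpP σ hσ t ht0 ht1
  rw [hmix] at h1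
  have hreal : f ρ - f σ ≤ ε * f p + (1 + ε) * (a t + b t) := by
    have hεt : (1 + ε) * t = ε := by rw [ht]; field_simp
    have hεs : (1 + ε) * (1 - t) = 1 := by rw [hs]; field_simp
    have h3 := mul_le_mul_of_nonneg_left (h1.trans h2) h1ε.le
    have h4 : (1 + ε) * (t * f q + (1 - t) * f ρ - a t) = ε * f q + f ρ - (1 + ε) * a t := by
      linear_combination f q * hεt + f ρ * hεs
    have h5 : (1 + ε) * (t * f p + (1 - t) * f σ + b t) = ε * f p + f σ + (1 + ε) * b t := by
      linear_combination f p * hεt + f σ * hεs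
    have h6 := mul_nonneg hpos.le (hfnn q hqP)
    linarith
  refine (EReal.coe_le_coe_iff.2 hreal).trans ?_
  rw [EReal.coe_add, EReal.coe_mul ε]
  gcongr
  exact le_sSup ⟨p, inferInstance, hp, rfl⟩
end

section
/- Let n ≥ 1, m ≤ n, and let P₀ be a convex set of probability distributions on ℕⁿ with the Δ-property. Let f : P₀ → ℝ be a nonnegative function belonging to the class T_n^m(C,D) on P₀. Let p ∈ P₀ be such that for k = 1,…,m the marginals p_k have finite support, and set d = ∏_{k=1}^m |supp p_k|. Then for every q ∈ P₀ and every ε ∈ (0,1] with TV(p,q) ≤ ε one has f(p) − f(q) ≤ C·ε·ln d + D·g(ε). -/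
open scoped ENNReal
/-- `p` is a probability distribution on `α`: nonnegative entries summing to `1`. -/
def IsProbDist {α : Type*} (p : α → ℝ) : Prop := (∀ x, 0 ≤ p x) ∧ HasSum p 1

/-- Extended-real-valued Shannon entropy `H(r) = ∑ η(r i) ∈ [0,+∞]`,
where `η(x) = −x ln x`. -/
noncomputable def shEnt (r : ℕ → ℝ) : ℝ≥0∞ :=
  ∑' i, ENNReal.ofReal (Real.negMulLog (r i))

/-- Total variation distance `TV(p,q) = (1/2)·∑ |p x − q x|`. -/
noncomputable def TVd {α : Type*} (p q : α → ℝ) : ℝ := (1 / 2) * ∑' x, |p x - q x|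

/-- `g(x) = (x+1)·ln(x+1) − x·ln x` (with `g(0) = 0`, as `Real.log 0 = 0`). -/
noncomputable def gFun (x : ℝ) : ℝ := (x + 1) * Real.log (x + 1) - x * Real.log x

/-- Binary entropy `h₂(x) = η(x) + η(1−x)`. -/
noncomputable def h2 (x : ℝ) : ℝ := Real.negMulLog x + Real.negMulLog (1 - x)

/-- The `k`-th marginal of a distribution on `ℕⁿ`. -/
noncomputable def margN {n : ℕ} (p : (Fin n → ℕ) → ℝ) (k : Fin n) (j : ℕ) : ℝ :=
  ∑' x : Fin n → ℕ, if x k = j then p x else 0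

/-- `P₀` is convex (as a set of functions). -/
def ConvexDist {α : Type*} (P₀ : Set (α → ℝ)) : Prop :=
  ∀ p ∈ P₀, ∀ q ∈ P₀, ∀ lam : ℝ, 0 ≤ lam → lam ≤ 1 →
    (fun x => lam * p x + (1 - lam) * q x) ∈ P₀

/-- The Δ-property: for distinct `p, q ∈ P₀` the normalized positive and negative
parts of `p − q` belong to `P₀`. -/
def DeltaProp {α : Type*} (P₀ : Set (α → ℝ)) : Prop :=
  ∀ p ∈ P₀, ∀ q ∈ P₀, p ≠ q →
    (fun x => max (p x - q x) 0 / TVd p q) ∈ P₀ ∧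
    (fun x => max (q x - p x) 0 / TVd p q) ∈ P₀

/-- The sum `∑_{k=1}^m H(p_k)` of the entropies of the first `m` marginals. -/
noncomputable def margEntSum {n : ℕ} (m : ℕ) (p : (Fin n → ℕ) → ℝ) : ℝ≥0∞ :=
  ∑ k ∈ Finset.univ.filter (fun k : Fin n => (k : ℕ) < m), shEnt (margN p k)

/-- Membership in the class `T_n^m(C,D)` on `P₀`. -/
def InClassT {n : ℕ} (m : ℕ) (C D : ℝ) (P₀ : Set ((Fin n → ℕ) → ℝ))
    (f : ((Fin n → ℕ) → ℝ) → ℝ) : Prop :=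
  ∃ cm cp dm dp : ℝ, 0 ≤ cm ∧ 0 ≤ cp ∧ 0 ≤ dm ∧ 0 ≤ dp ∧
    cm + cp = C ∧ dm + dp = D ∧
    (∀ p ∈ P₀, ∀ q ∈ P₀, ∀ lam : ℝ, 0 ≤ lam → lam ≤ 1 →
      lam * f p + (1 - lam) * f q - dm * h2 lam ≤
        f (fun x => lam * p x + (1 - lam) * q x) ∧
      f (fun x => lam * p x + (1 - lam) * q x) ≤
        lam * f p + (1 - lam) * f q + dp * h2 lam) ∧
    (∀ p ∈ P₀, margEntSum m p ≠ ⊤ →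
      -(cm * (margEntSum m p).toReal) ≤ f p ∧ f p ≤ cp * (margEntSum m p).toReal)


theorem gFun_eq_negMulLog (x : ℝ) :
    gFun x = Real.negMulLog x - Real.negMulLog (x + 1) := by
  simp only [gFun, Real.negMulLog]
  ring

theorem gFun_monotoneOn : MonotoneOn gFun (Set.Ici 0) := by
  have hg : gFun = fun x => Real.negMulLog x - Real.negMulLog (x + 1) :=
    funext gFun_eq_negMulLog
  have hderiv : ∀ x : ℝ, 0 < x → HasDerivAt gFun
      ((-Real.log x - 1) - (-Real.log (x + 1) - 1)) x := by
    intro x hx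
    rw [hg]
    exact (Real.hasDerivAt_negMulLog hx.ne').sub
      ((Real.hasDerivAt_negMulLog (by positivity : x + 1 ≠ 0)).comp_add_const x 1)
  refine monotoneOn_of_deriv_nonneg (convex_Ici 0) ?_ ?_ ?_
  · rw [hg]
    exact (Real.continuous_negMulLog.sub
      (Real.continuous_negMulLog.comp (continuous_id.add continuous_const))).continuousOn
  · intro x hx
    rw [interior_Ici] at hx
    exact (hderiv x hx).differentiableAt.differentiableWithinAt
  · intro x hx
    rw [interior_Ici] at hx
    rw [(hderiv x hx).deriv]
    have := Real.log_le_log hx (by linarith : x ≤ x + 1)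
    linarith

theorem gFun_nonneg {x : ℝ} (hx : 0 ≤ x) : 0 ≤ gFun x := by
  have h := gFun_monotoneOn (Set.mem_Ici.2 le_rfl) (Set.mem_Ici.2 hx) hx
  simpa [gFun] using h

theorem one_add_mul_h2_inv {x : ℝ} (hx : 0 < x) : (1 + x) * h2 (1 / (1 + x)) = gFun x := by
  have h1 : (1 + x) ≠ 0 := by positivity
  have h : 1 - 1 / (1 + x) = x / (1 + x) := by field_simp; ring
  rw [h2, h, Real.negMulLog, Real.negMulLog, gFun, Real.log_div one_ne_zero h1,
    Real.log_div hx.ne' h1, Real.log_one, add_comm x 1]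
  field_simp
  ring

/-- The uniform distribution maximizes the entropy among distributions on a finite set. -/
theorem sum_negMulLog_le_log_card {ι : Type*} (s : Finset ι) (r : ι → ℝ)
    (hr : ∀ i ∈ s, 0 ≤ r i) (hsum : ∑ i ∈ s, r i = 1) :
    ∑ i ∈ s, Real.negMulLog (r i) ≤ Real.log s.card := by
  have hne : s.Nonempty := by
    rw [Finset.nonempty_iff_ne_empty]
    rintro rfl
    simp at hsum
  have hc : (0 : ℝ) < s.card := by exact_mod_cast hne.card_pos
  have h := Real.concaveOn_negMulLog.le_map_sum (t := s) (w := fun _ => (s.card : ℝ)⁻¹) (p := r)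
    (fun _ _ => by positivity) (by simp [hc.ne']) (fun i hi => hr i hi)
  simp only [smul_eq_mul, ← Finset.mul_sum, hsum, mul_one] at h
  rw [Real.negMulLog, Real.log_inv] at h
  have h' : (s.card : ℝ)⁻¹ * ∑ i ∈ s, Real.negMulLog (r i) ≤
      (s.card : ℝ)⁻¹ * Real.log s.card := by linarith
  exact le_of_mul_le_mul_left h' (by positivity)

theorem shEnt_le_log_card (s : Finset ℕ) (r : ℕ → ℝ) (hr : ∀ i, 0 ≤ r i)
    (hs : ∀ i ∉ s, r i = 0) (hsum : ∑ i ∈ s, r i = 1) :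
    shEnt r ≤ ENNReal.ofReal (Real.log s.card) := by
  rw [shEnt, tsum_eq_sum (s := s) (fun i hi => by simp [hs i hi]),
    ← ENNReal.ofReal_sum_of_nonneg]
  · exact ENNReal.ofReal_le_ofReal (sum_negMulLog_le_log_card s r (fun i _ => hr i) hsum)
  · intro i hi
    exact Real.negMulLog_nonneg (hr i)
      (hsum ▸ Finset.single_le_sum (fun j _ => hr j) hi)

theorem summable_marg {n : ℕ} {t : (Fin n → ℕ) → ℝ} (ht : IsProbDist t) (k : Fin n) (j : ℕ) :
    Summable fun x : Fin n → ℕ => if x k = j then t x else 0 :=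
  Summable.of_nonneg_of_le (fun x => by split_ifs <;> simp [ht.1 x])
    (fun x => by split_ifs <;> simp [ht.1 x]) ht.2.summable

theorem margN_nonneg {n : ℕ} {t : (Fin n → ℕ) → ℝ} (ht : IsProbDist t) (k : Fin n) (j : ℕ) :
    0 ≤ margN t k j :=
  tsum_nonneg fun x => by split_ifs <;> simp [ht.1 x]

theorem le_margN {n : ℕ} {t : (Fin n → ℕ) → ℝ} (ht : IsProbDist t) (k : Fin n)
    (x : Fin n → ℕ) : t x ≤ margN t k (x k) := by
  have h := (summable_marg ht k (x k)).le_tsum x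
    (fun y _ => by split_ifs <;> simp [ht.1 y])
  simpa [margN] using h

theorem sum_margN_eq_one {n : ℕ} {t : (Fin n → ℕ) → ℝ} (ht : IsProbDist t) (k : Fin n)
    (s : Finset ℕ) (hs : ∀ x, t x ≠ 0 → x k ∈ s) : ∑ j ∈ s, margN t k j = 1 := by
  simp only [margN]
  rw [← Summable.tsum_finsetSum (fun j _ => summable_marg ht k j), ← ht.2.tsum_eq]
  refine tsum_congr fun x => ?_
  rw [Finset.sum_ite_eq]
  split_ifs with h
  · rfl
  · by_contra hne
    exact h (hs x (Ne.symm hne))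

theorem margN_eq_zero {n : ℕ} {t : (Fin n → ℕ) → ℝ} (k : Fin n) (s : Finset ℕ)
    (hs : ∀ x, t x ≠ 0 → x k ∈ s) {j : ℕ} (hj : j ∉ s) : margN t k j = 0 := by
  refine (tsum_congr fun x => ?_).trans tsum_zero
  split_ifs with h
  · by_contra hne
    exact hj (h ▸ hs x hne)
  · rfl

theorem support_margN_nonempty {n : ℕ} {p : (Fin n → ℕ) → ℝ} (hp : IsProbDist p) (k : Fin n) :
    (Function.support (margN p k)).Nonempty := by
  have hne : ∃ x, p x ≠ 0 := by
    by_contra! h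
    have := hp.2.tsum_eq
    simp [h] at this
  obtain ⟨x, hx⟩ := hne
  exact ⟨x k, ((lt_of_le_of_ne (hp.1 x) hx.symm).trans_le (le_margN hp k x)).ne'⟩

/-- If `t` vanishes wherever `p` does, the entropies of the marginals of `t` are controlled by
the cardinalities of the supports of the marginals of `p`. -/
theorem margEntSum_le_log_prod {n m : ℕ} {p t : (Fin n → ℕ) → ℝ}
    (hp : IsProbDist p) (ht : IsProbDist t) (htp : ∀ x, t x ≠ 0 → p x ≠ 0)
    (hfinp : ∀ k : Fin n, (k : ℕ) < m → (Function.support (margN p k)).Finite) :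
    margEntSum m t ≤ ENNReal.ofReal (Real.log
      ((∏ k ∈ Finset.univ.filter (fun k : Fin n => (k : ℕ) < m),
        (Function.support (margN p k)).ncard : ℕ) : ℝ)) := by
  have hpos : ∀ k ∈ Finset.univ.filter (fun k : Fin n => (k : ℕ) < m),
      0 < (Function.support (margN p k)).ncard := fun k hk =>
    (Set.ncard_pos (hfinp k (Finset.mem_filter.1 hk).2)).2 (support_margN_nonempty hp k)
  rw [Nat.cast_prod, Real.log_prod (fun k hk => by exact_mod_cast (hpos k hk).ne'),
    ENNReal.ofReal_sum_of_nonneg (fun k _ => Real.log_natCast_nonneg _)]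
  refine Finset.sum_le_sum fun k hk => ?_
  have hfin := hfinp k (Finset.mem_filter.1 hk).2
  have hs : ∀ x, t x ≠ 0 → x k ∈ hfin.toFinset := fun x hx =>
    hfin.mem_toFinset.2
      ((lt_of_le_of_ne (hp.1 x) (htp x hx).symm).trans_le (le_margN hp k x)).ne'
  rw [Set.ncard_eq_toFinset_card _ hfin]
  exact shEnt_le_log_card _ _ (margN_nonneg ht k) (fun j hj => margN_eq_zero k _ hs hj)
    (sum_margN_eq_one ht k _ hs)

theorem TVd_pos {α : Type*} {p q : α → ℝ} (hp : IsProbDist p) (hq : IsProbDist q)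
    (hne : p ≠ q) : 0 < TVd p q := by
  obtain ⟨x, hx⟩ := Function.ne_iff.1 hne
  have h : 0 < ∑' y, |p y - q y| :=
    (hp.2.summable.sub hq.2.summable).abs.tsum_pos (fun y => abs_nonneg _) x
      (abs_pos.2 (sub_ne_zero.2 hx))
  rw [TVd]
  positivity

/-- **One-sided continuity bound under a rank (finite-support) constraint on the
first distribution only**, for nonnegative functions of the class `T_n^m(C,D)` on
a convex set `P₀` with the Δ-property:
`f(p) − f(q) ≤ C·ε·ln d + D·g(ε)` where `d = ∏_{k≤m} |supp p_k|`;
no constraint is imposed on `q` other than `TV(p,q) ≤ ε`. -/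
theorem classT_rank_one_side_bound {n m : ℕ} (hn : 1 ≤ n) (hmn : m ≤ n)
    (P₀ : Set ((Fin n → ℕ) → ℝ)) (hprob : ∀ p ∈ P₀, IsProbDist p)
    (hconv : ConvexDist P₀) (hdelta : DeltaProp P₀)
    (C D : ℝ) (hC : 0 ≤ C) (hD : 0 ≤ D)
    (f : ((Fin n → ℕ) → ℝ) → ℝ) (hf : InClassT m C D P₀ f)
    (hfnn : ∀ r ∈ P₀, 0 ≤ f r)
    (p : (Fin n → ℕ) → ℝ) (hp : p ∈ P₀)
    (hfinp : ∀ k : Fin n, (k : ℕ) < m → (Function.support (margN p k)).Finite)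
    (d : ℕ)
    (hd : d = ∏ k ∈ Finset.univ.filter (fun k : Fin n => (k : ℕ) < m),
        (Function.support (margN p k)).ncard)
    (q : (Fin n → ℕ) → ℝ) (hq : q ∈ P₀)
    (ε : ℝ) (hε0 : 0 < ε) (hε1 : ε ≤ 1) (hTV : TVd p q ≤ ε) :
    f p - f q ≤ C * ε * Real.log d + D * gFun ε := by
  obtain ⟨cm, cp, dm, dp, hcm, hcp, hdm, hdp, hcC, hdD, hmix, hbd⟩ := hf
  have hlog : 0 ≤ Real.log d := Real.log_natCast_nonneg d
  have hgε := gFun_nonneg hε0.le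
  rcases eq_or_ne p q with rfl | hne
  · rw [sub_self]
    positivity
  have hδ := TVd_pos (hprob p hp) (hprob q hq) hne
  obtain ⟨htp, htm⟩ := hdelta p hp q hq hne
  set δ := TVd p q with hδdef
  set tp : (Fin n → ℕ) → ℝ := fun x => max (p x - q x) 0 / δ with htp_def
  set tm : (Fin n → ℕ) → ℝ := fun x => max (q x - p x) 0 / δ with htm_def
  have htp_supp : ∀ x, tp x ≠ 0 → p x ≠ 0 := by
    intro x hx hpx
    refine hx ?_
    have := (hprob q hq).1 x
    simp [htp_def, hpx, this]
  have hent := margEntSum_le_log_prod (m := m) (hprob p hp) (hprob tp htp) htp_supp hfinp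
  rw [← hd] at hent
  have hftp : f tp ≤ C * Real.log d := by
    calc f tp ≤ cp * (margEntSum m tp).toReal :=
          (hbd tp htp (ne_top_of_le_ne_top ENNReal.ofReal_ne_top hent)).2
      _ ≤ cp * Real.log d := by
          gcongr
          exact ENNReal.toReal_le_of_le_ofReal hlog hent
      _ ≤ C * Real.log d := by
          gcongr
          linarith
  have hδ1 : (1 + δ) ≠ 0 := by positivity
  have hlam0 : 0 ≤ 1 / (1 + δ) := by positivity
  have hlam1 : 1 / (1 + δ) ≤ 1 := by
    rw [div_le_one (by positivity)]
    linarith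
  have hmix_eq : (fun x => 1 / (1 + δ) * p x + (1 - 1 / (1 + δ)) * tm x) =
      fun x => 1 / (1 + δ) * q x + (1 - 1 / (1 + δ)) * tp x := by
    funext x
    simp only [htp_def, htm_def]
    have h : p x + max (q x - p x) 0 = q x + max (p x - q x) 0 := by
      rcases le_total (p x) (q x) with h | h
      · rw [max_eq_left (by linarith), max_eq_right (by linarith)]
        ring
      · rw [max_eq_right (by linarith), max_eq_left (by linarith)]
        ring
    field_simp
    linear_combination δ * h
  have hlow := (hmix p hp tm htm _ hlam0 hlam1).1
  have hupp := (hmix q hq tp htp _ hlam0 hlam1).2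
  rw [hmix_eq] at hlow
  have hmul := mul_le_mul_of_nonneg_left (hlow.trans hupp) (by positivity : 0 ≤ 1 + δ)
  have hh := one_add_mul_h2_inv hδ
  have e : (1 + δ) * (1 / (1 + δ)) = 1 := by field_simp
  have hineq : f p + δ * f tm - dm * gFun δ ≤ f q + δ * f tp + dp * gFun δ := by
    linear_combination hmul + (dm + dp) * hh + (f q - f p + f tm - f tp) * e
  have hg : gFun δ ≤ gFun ε := gFun_monotoneOn (Set.mem_Ici.2 hδ.le) (Set.mem_Ici.2 hε0.le) hTV
  have h1 : δ * f tp ≤ ε * (C * Real.log d) :=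
    mul_le_mul hTV hftp (hfnn tp htp) hε0.le
  have h2 : 0 ≤ δ * f tm := mul_nonneg hδ.le (hfnn tm htm)
  have h3 : D * gFun δ ≤ D * gFun ε := mul_le_mul_of_nonneg_left hg hD
  rw [← hdD] at h3 ⊢
  linarith
end

section
/- Let E : ℕ → ℝ be a nondecreasing sequence with E 0 = 0 and E i ≥ 0 satisfying the Gibbs condition, and let F_E be the associated maximal-entropy function. Let p be a probability distribution on ℕ with ∑_i (E i)·(p i) ≤ t for some t > 0. Then for every probability distribution q on ℕ and every ε ∈ (0,1] with TV(p,q) ≤ ε one has H(p) − H(q) ≤ ε·F_E((t − t_ε(p))/ε) + g(ε) ≤ ε·F_E(t/ε) + g(ε), where t_ε(p) = ∑_i (E i)·max(p i − ε, 0), H(q) is taken in [0,+∞], and the inequality is read in the extended reals. No constraint is imposed on q other than TV(p,q) ≤ ε. -/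
open scoped ENNReal

/-- The Gibbs condition: `∑_i exp(−β·E i) < ∞` for every `β > 0`. -/
def GibbsCond (E : ℕ → ℝ) : Prop :=
  ∀ β : ℝ, 0 < β → Summable fun i => Real.exp (-β * E i)

/-- The mean energy `∑_i E i · p i ∈ [0,+∞]` (the terms being nonnegative for
probability distributions and nonnegative `E`). -/
noncomputable def meanE (E : ℕ → ℝ) (p : ℕ → ℝ) : ℝ≥0∞ :=
  ∑' i, ENNReal.ofReal (E i * p i)

/-- The maximal-entropy function
`F_E(t) = sup{ H(p) : p prob. distribution on ℕ, ∑ E i · p i ≤ t }`. -/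
noncomputable def FE (E : ℕ → ℝ) (t : ℝ) : ℝ :=
  sSup {h : ℝ | ∃ p : ℕ → ℝ, IsProbDist p ∧ meanE E p ≤ ENNReal.ofReal t ∧
    h = (shEnt p).toReal}

/-- The function `η(x) = -x ln x` is subadditive on `[0, ∞)`. -/
lemma negMulLog_add_le {x y : ℝ} (hx : 0 ≤ x) (hy : 0 ≤ y) :
    Real.negMulLog (x + y) ≤ Real.negMulLog x + Real.negMulLog y := by
  rcases hx.eq_or_lt with rfl | hx'
  · simp
  rcases hy.eq_or_lt with rfl | hy'
  · simp
  have h1 : Real.log x ≤ Real.log (x + y) := Real.log_le_log hx' (by linarith)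
  have h2 : Real.log y ≤ Real.log (x + y) := Real.log_le_log hy' (by linarith)
  simp only [Real.negMulLog]
  nlinarith [mul_le_mul_of_nonneg_left h1 hx, mul_le_mul_of_nonneg_left h2 hy]

/-- Concavity of `η` gives `η(a) ≤ (1 + ε) η((a + d) / (1 + ε))` for `0 ≤ d ≤ ε`. -/
lemma negMulLog_le_negMulLog_add {a d ε : ℝ} (ha : 0 ≤ a) (hd : 0 ≤ d) (hdε : d ≤ ε)
    (hε : 0 < ε) :
    Real.negMulLog a ≤ Real.negMulLog (a + d) + (a + d) * Real.log (1 + ε) := by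
  have hs : (0 : ℝ) < 1 + ε := by linarith
  have hnn : 0 ≤ Real.negMulLog (d / ε) :=
    Real.negMulLog_nonneg (by positivity) ((div_le_one hε).2 hdε)
  have hconc := Real.concaveOn_negMulLog.2 (Set.mem_Ici.2 ha)
    (Set.mem_Ici.2 (div_nonneg hd hε.le))
    (by positivity : 0 ≤ 1 / (1 + ε)) (by positivity : 0 ≤ ε / (1 + ε)) (by field_simp)
  simp only [smul_eq_mul] at hconc
  have e1 : 1 / (1 + ε) * a + ε / (1 + ε) * (d / ε) = (a + d) * (1 + ε)⁻¹ := by field_simp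
  have e2 : (1 + ε)⁻¹.negMulLog = (1 + ε)⁻¹ * Real.log (1 + ε) := by
    simp [Real.negMulLog, Real.log_inv]
  rw [e1, Real.negMulLog_mul, e2] at hconc
  have h3 : 1 / (1 + ε) * Real.negMulLog a ≤ (1 + ε)⁻¹ * Real.negMulLog (a + d) +
      (a + d) * ((1 + ε)⁻¹ * Real.log (1 + ε)) :=
    le_trans (le_add_of_nonneg_right (by positivity)) hconc
  have h4 := mul_le_mul_of_nonneg_left h3 hs.le
  have e3 : (1 + ε) * (1 / (1 + ε) * Real.negMulLog a) = Real.negMulLog a := by field_simp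
  have e4 : (1 + ε) * ((1 + ε)⁻¹ * Real.negMulLog (a + d) +
      (a + d) * ((1 + ε)⁻¹ * Real.log (1 + ε))) =
      Real.negMulLog (a + d) + (a + d) * Real.log (1 + ε) := by field_simp
  rwa [e3, e4] at h4

/-- Pointwise form of the Alicki–Fannes–Winter estimate. -/
lemma negMulLog_le_of_le_add_mul {a b u ε : ℝ} (ha : 0 ≤ a) (hb : 0 ≤ b) (hu : 0 ≤ u)
    (hε : 0 < ε) (hle : a ≤ b + ε * u) (hle' : b + ε * u - a ≤ ε) :
    Real.negMulLog a ≤ Real.negMulLog b + ε * Real.negMulLog u +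
      (b * Real.log (1 + ε) + u * (ε * Real.log (1 + ε) - ε * Real.log ε)) := by
  have h1 := negMulLog_le_negMulLog_add ha (sub_nonneg.2 hle) hle' hε
  have h2 := negMulLog_add_le hb (mul_nonneg hε.le hu)
  rw [Real.negMulLog_mul] at h2
  have e : a + (b + ε * u - a) = b + ε * u := by ring
  have e' : Real.negMulLog ε = -ε * Real.log ε := rfl
  rw [e] at h1
  rw [e'] at h2
  linarith

lemma IsProbDist.le_one {α : Type*} {p : α → ℝ} (hp : IsProbDist p) (i : α) : p i ≤ 1 :=
  le_hasSum hp.2 i fun j _ => hp.1 j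

lemma IsProbDist.negMulLog_nonneg {α : Type*} {p : α → ℝ} (hp : IsProbDist p) (i : α) :
    0 ≤ Real.negMulLog (p i) :=
  Real.negMulLog_nonneg (hp.1 i) (hp.le_one i)

/-- If `p ≤ q + ε u` with `q + ε u - p ≤ ε` pointwise, then `H(p) ≤ H(q) + ε H(u) + g(ε)`. -/
lemma shEnt_le_add_of_le_add_mul {p q u : ℕ → ℝ} {ε : ℝ} (hp : IsProbDist p)
    (hq : IsProbDist q) (hu : IsProbDist u) (hε : 0 < ε) (hε1 : ε ≤ 1)
    (hle : ∀ i, p i ≤ q i + ε * u i) (hle' : ∀ i, q i + ε * u i - p i ≤ ε) :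
    shEnt p ≤ shEnt q + ENNReal.ofReal ε * shEnt u + ENNReal.ofReal (gFun ε) := by
  have hlog : 0 ≤ Real.log (1 + ε) := Real.log_nonneg (by linarith)
  have hlog' : Real.log ε ≤ 0 := Real.log_nonpos hε.le hε1
  have hc : 0 ≤ ε * Real.log (1 + ε) - ε * Real.log ε := by nlinarith
  have hsum : HasSum (fun i => q i * Real.log (1 + ε) +
      u i * (ε * Real.log (1 + ε) - ε * Real.log ε)) (gFun ε) := by
    have hg : gFun ε = 1 * Real.log (1 + ε) +
        1 * (ε * Real.log (1 + ε) - ε * Real.log ε) := by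
      rw [gFun, add_comm ε 1]
      ring
    rw [hg]
    exact (hq.2.mul_right _).add (hu.2.mul_right _)
  have hnn : ∀ i, 0 ≤ q i * Real.log (1 + ε) +
      u i * (ε * Real.log (1 + ε) - ε * Real.log ε) := fun i =>
    add_nonneg (mul_nonneg (hq.1 i) hlog) (mul_nonneg (hu.1 i) hc)
  rw [← hsum.tsum_eq, ENNReal.ofReal_tsum_of_nonneg hnn hsum.summable, shEnt, shEnt, shEnt,
    ← ENNReal.tsum_mul_left, ← ENNReal.tsum_add, ← ENNReal.tsum_add]
  refine ENNReal.tsum_le_tsum fun i => ?_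
  rw [← ENNReal.ofReal_mul hε.le, ← ENNReal.ofReal_add (hq.negMulLog_nonneg i)
      (mul_nonneg hε.le (hu.negMulLog_nonneg i)),
    ← ENNReal.ofReal_add (add_nonneg (hq.negMulLog_nonneg i)
      (mul_nonneg hε.le (hu.negMulLog_nonneg i))) (hnn i)]
  exact ENNReal.ofReal_le_ofReal
    (negMulLog_le_of_le_add_mul (hp.1 i) (hq.1 i) (hu.1 i) hε (hle i) (hle' i))

lemma negMulLog_le_mul_add_exp {x : ℝ} (hx : 0 ≤ x) (y : ℝ) :
    Real.negMulLog x ≤ y * x + Real.exp (-1 * y) := by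
  rcases hx.eq_or_lt with rfl | hx
  · simpa using (Real.exp_pos _).le
  have h := Real.log_le_sub_one_of_pos (div_pos (Real.exp_pos (-1 * y)) hx)
  rw [Real.log_div (Real.exp_pos _).ne' hx.ne', Real.log_exp] at h
  have h2 := mul_le_mul_of_nonneg_left h hx.le
  rw [mul_sub x (Real.exp (-1 * y) / x) 1, mul_div_cancel₀ _ hx.ne'] at h2
  simp only [Real.negMulLog]
  nlinarith

/-- Under the Gibbs condition the entropy is bounded on sets of bounded mean energy. -/
lemma shEnt_le_of_meanE_le {E : ℕ → ℝ} (hEnn : ∀ i, 0 ≤ E i) (hGibbs : GibbsCond E)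
    {p : ℕ → ℝ} (hp : IsProbDist p) {t : ℝ} (hpt : meanE E p ≤ ENNReal.ofReal t) :
    shEnt p ≤ ENNReal.ofReal t + ENNReal.ofReal (∑' i, Real.exp (-1 * E i)) := by
  rw [ENNReal.ofReal_tsum_of_nonneg (fun i => (Real.exp_pos _).le) (hGibbs 1 one_pos)]
  refine le_trans ?_ (add_le_add_left hpt _)
  rw [meanE, shEnt, ← ENNReal.tsum_add]
  refine ENNReal.tsum_le_tsum fun i => ?_
  rw [← ENNReal.ofReal_add (mul_nonneg (hEnn i) (hp.1 i)) (Real.exp_pos _).le]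
  exact ENNReal.ofReal_le_ofReal (negMulLog_le_mul_add_exp (hp.1 i) (E i))

lemma shEnt_ne_top_of_meanE_le {E : ℕ → ℝ} (hEnn : ∀ i, 0 ≤ E i) (hGibbs : GibbsCond E)
    {p : ℕ → ℝ} (hp : IsProbDist p) {t : ℝ} (hpt : meanE E p ≤ ENNReal.ofReal t) :
    shEnt p ≠ ∞ :=
  ne_top_of_le_ne_top (by simp) (shEnt_le_of_meanE_le hEnn hGibbs hp hpt)

lemma bddAbove_entropies {E : ℕ → ℝ} (hEnn : ∀ i, 0 ≤ E i) (hGibbs : GibbsCond E) (t : ℝ) :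
    BddAbove {h : ℝ | ∃ p : ℕ → ℝ, IsProbDist p ∧ meanE E p ≤ ENNReal.ofReal t ∧
      h = (shEnt p).toReal} := by
  refine ⟨(ENNReal.ofReal t + ENNReal.ofReal (∑' i, Real.exp (-1 * E i))).toReal, ?_⟩
  rintro h ⟨p, hp, hpt, rfl⟩
  exact ENNReal.toReal_mono (by simp) (shEnt_le_of_meanE_le hEnn hGibbs hp hpt)

lemma shEnt_le_ofReal_FE {E : ℕ → ℝ} (hEnn : ∀ i, 0 ≤ E i) (hGibbs : GibbsCond E)
    {p : ℕ → ℝ} (hp : IsProbDist p) {t : ℝ} (hpt : meanE E p ≤ ENNReal.ofReal t) :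
    shEnt p ≤ ENNReal.ofReal (FE E t) :=
  ENNReal.le_ofReal_iff_toReal_le (shEnt_ne_top_of_meanE_le hEnn hGibbs hp hpt)
    (ENNReal.toReal_nonneg.trans
      (le_csSup (bddAbove_entropies hEnn hGibbs t) ⟨p, hp, hpt, rfl⟩)) |>.2
    (le_csSup (bddAbove_entropies hEnn hGibbs t) ⟨p, hp, hpt, rfl⟩)

lemma isProbDist_single (i : ℕ) : IsProbDist (Pi.single i 1 : ℕ → ℝ) :=
  ⟨fun j => by by_cases h : j = i <;> simp [h], hasSum_pi_single i 1⟩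

lemma meanE_single_zero {E : ℕ → ℝ} (hE0 : E 0 = 0) : meanE E (Pi.single 0 1) = 0 := by
  rw [meanE, ENNReal.tsum_eq_zero]
  intro i
  rcases eq_or_ne i 0 with rfl | h
  · simp [hE0]
  · simp [h]

lemma FE_nonneg (E : ℕ → ℝ) (t : ℝ) : 0 ≤ FE E t := by
  refine Real.sSup_nonneg ?_
  rintro h ⟨p, -, -, rfl⟩
  exact ENNReal.toReal_nonneg

lemma FE_mono {E : ℕ → ℝ} (hE0 : E 0 = 0) (hEnn : ∀ i, 0 ≤ E i) (hGibbs : GibbsCond E) :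
    Monotone (FE E) := by
  intro s t hst
  refine csSup_le_csSup (bddAbove_entropies hEnn hGibbs t)
    ⟨_, Pi.single 0 1, isProbDist_single 0, by simp [meanE_single_zero hE0], rfl⟩ ?_
  rintro h ⟨p, hp, hps, rfl⟩
  exact ⟨p, hp, hps.trans (ENNReal.ofReal_le_ofReal hst), rfl⟩

lemma TVd_comm {α : Type*} (p q : α → ℝ) : TVd p q = TVd q p := by
  simp only [TVd, abs_sub_comm]

lemma IsProbDist.hasSum_max_sub {α : Type*} {p q : α → ℝ} (hp : IsProbDist p)
    (hq : IsProbDist q) : HasSum (fun i => max (p i - q i) 0) (TVd p q) := by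
  have hs := hp.2.sub hq.2
  have h1 : (fun i => max (p i - q i) 0) =
      fun i => (1 / 2 : ℝ) * (|p i - q i| + (p i - q i)) := by
    funext i
    rcases le_total (p i - q i) 0 with h | h
    · rw [max_eq_right h, abs_of_nonpos h]; ring
    · rw [max_eq_left h, abs_of_nonneg h]; ring
  have h2 : TVd p q = 1 / 2 * (∑' i, |p i - q i| + (1 - 1)) := by simp [TVd]
  rw [h1, h2]
  exact (hs.summable.abs.hasSum.add hs).mul_left _

lemma IsProbDist.max_sub_le_TVd {α : Type*} {p q : α → ℝ} (hp : IsProbDist p)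
    (hq : IsProbDist q) (i : α) : max (p i - q i) 0 ≤ TVd p q :=
  le_hasSum (hp.hasSum_max_sub hq) i fun _ _ => le_max_right _ _

/-- **One-sided continuity bound for the Shannon entropy under an energy-type
constraint imposed only on the first distribution** (classical form of the
paper's Proposition on the von Neumann entropy): if `∑ E i · p i ≤ t` then for
any probability distribution `q` with `TV(p,q) ≤ ε ≤ 1`,
`H(p) − H(q) ≤ ε·F_E((t − t_ε(p))/ε) + g(ε) ≤ ε·F_E(t/ε) + g(ε)`
(in the extended reals), where `t_ε(p) = ∑ E i · max(p i − ε, 0)`. -/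
theorem entropy_energy_one_side_bound
    (E : ℕ → ℝ) (hmono : Monotone E) (hE0 : E 0 = 0) (hEnn : ∀ i, 0 ≤ E i)
    (hGibbs : GibbsCond E) (t : ℝ) (ht : 0 < t)
    (p : ℕ → ℝ) (hp : IsProbDist p) (hpt : meanE E p ≤ ENNReal.ofReal t)
    (q : ℕ → ℝ) (hq : IsProbDist q)
    (ε : ℝ) (hε0 : 0 < ε) (hε1 : ε ≤ 1) (hTV : TVd p q ≤ ε) :
    (shEnt p : EReal) - (shEnt q : EReal) ≤
      ((ε * FE E ((t - ∑' i, E i * max (p i - ε) 0) / ε) + gFun ε : ℝ) : EReal) ∧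
    ε * FE E ((t - ∑' i, E i * max (p i - ε) 0) / ε) + gFun ε ≤
      ε * FE E (t / ε) + gFun ε := by
  have hEp : ∀ i, 0 ≤ E i * p i := fun i => mul_nonneg (hEnn i) (hp.1 i)
  have hsEp : Summable fun i => E i * p i := by
    have h := ENNReal.summable_toReal (ne_top_of_le_ne_top ENNReal.ofReal_ne_top hpt)
    simpa only [ENNReal.toReal_ofReal (hEp _)] using h
  have hEt : ∑' i, E i * p i ≤ t := by
    rw [meanE, ← ENNReal.ofReal_tsum_of_nonneg hEp hsEp] at hpt
    exact (ENNReal.ofReal_le_ofReal_iff ht.le).1 hpt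
  have hT : ∀ i, 0 ≤ E i * max (p i - ε) 0 := fun i =>
    mul_nonneg (hEnn i) (le_max_right _ _)
  have hsT : Summable fun i => E i * max (p i - ε) 0 :=
    hsEp.of_nonneg_of_le hT fun i =>
      mul_le_mul_of_nonneg_left (max_le (by linarith) (hp.1 i)) (hEnn i)
  set T := ∑' i, E i * max (p i - ε) 0 with hTdef
  have hT0 : 0 ≤ T := tsum_nonneg hT
  -- the excess `(p - q)⁺`, filled up to total mass `ε` at the zero-energy state
  set e : ℕ → ℝ := Pi.single 0 1 with he
  have hPe : IsProbDist e := isProbDist_single 0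
  set u : ℕ → ℝ := fun i => ε⁻¹ * (max (p i - q i) 0 + (ε - TVd p q) * e i) with hudef
  have hεu : ∀ i, ε * u i = max (p i - q i) 0 + (ε - TVd p q) * e i := fun i =>
    mul_inv_cancel_left₀ hε0.ne' _
  have hen : ∀ i, 0 ≤ (ε - TVd p q) * e i := fun i =>
    mul_nonneg (sub_nonneg.2 hTV) (hPe.1 i)
  have hu : IsProbDist u := by
    refine ⟨fun i => mul_nonneg (inv_nonneg.2 hε0.le)
      (add_nonneg (le_max_right _ _) (hen i)), ?_⟩
    have h1 : (1 : ℝ) = ε⁻¹ * (TVd p q + (ε - TVd p q) * 1) := by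
      field_simp
      ring
    rw [h1]
    exact ((hp.hasSum_max_sub hq).add (hPe.2.mul_left (ε - TVd p q))).mul_left ε⁻¹
  have hEe : ∀ i, E i * e i = 0 := by
    intro i
    rcases eq_or_ne i 0 with rfl | h
    · simp [hE0]
    · simp [he, h]
  have hEu : meanE E u ≤ ENNReal.ofReal ((t - T) / ε) := by
    have hs := (hsEp.sub hsT).div_const ε
    have hpos : ∀ i, E i * u i ≤ (E i * p i - E i * max (p i - ε) 0) / ε := by
      intro i
      rw [le_div_iff₀ hε0]
      have h1 : E i * u i * ε = E i * max (p i - q i) 0 := by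
        rw [mul_assoc, mul_comm (u i), hεu, mul_add, mul_left_comm, hEe, mul_zero, add_zero]
      rw [h1, ← mul_sub]
      refine mul_le_mul_of_nonneg_left ?_ (hEnn i)
      have h2 := (hp.max_sub_le_TVd hq i).trans hTV
      have h3 : max (p i - q i) 0 ≤ p i := max_le (by linarith [hq.1 i]) (hp.1 i)
      rcases max_cases (p i - ε) 0 with h | h <;> linarith
    have hnn : ∀ i, 0 ≤ (E i * p i - E i * max (p i - ε) 0) / ε := fun i =>
      (mul_nonneg (hEnn i) (hu.1 i)).trans (hpos i)
    calc meanE E u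
        ≤ ∑' i, ENNReal.ofReal ((E i * p i - E i * max (p i - ε) 0) / ε) :=
          ENNReal.tsum_le_tsum fun i => ENNReal.ofReal_le_ofReal (hpos i)
      _ = ENNReal.ofReal ((∑' i, E i * p i - T) / ε) := by
          rw [← ENNReal.ofReal_tsum_of_nonneg hnn hs, tsum_div_const, hsEp.tsum_sub hsT]
      _ ≤ ENNReal.ofReal ((t - T) / ε) :=
          ENNReal.ofReal_le_ofReal (by gcongr)
  refine ⟨?_, ?_⟩
  · have hmain := shEnt_le_add_of_le_add_mul hp hq hu hε0 hε1
      (fun i => by rw [hεu]; linarith [le_max_left (p i - q i) 0, hen i])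
      (fun i => by
        rw [hεu]
        have h1 := hq.max_sub_le_TVd hp i
        rw [TVd_comm] at h1
        have h2 := mul_le_mul_of_nonneg_left (hPe.le_one i) (sub_nonneg.2 hTV)
        rcases max_cases (p i - q i) 0 with h | h <;>
          linarith [le_max_left (q i - p i) 0, le_max_right (q i - p i) 0])
    have hg : 0 ≤ gFun ε := by
      have h1 : 0 ≤ Real.log (ε + 1) := Real.log_nonneg (by linarith)
      have h2 : Real.log ε ≤ 0 := Real.log_nonpos hε0.le hε1
      rw [gFun]
      nlinarith
    have hF := shEnt_le_ofReal_FE hEnn hGibbs hu hEu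
    have hF0 : 0 ≤ ε * FE E ((t - T) / ε) := mul_nonneg hε0.le (FE_nonneg _ _)
    have hfin : shEnt p ≤
        ENNReal.ofReal (ε * FE E ((t - T) / ε) + gFun ε) + shEnt q := by
      rw [ENNReal.ofReal_add hF0 hg, ENNReal.ofReal_mul hε0.le]
      calc shEnt p ≤ shEnt q + ENNReal.ofReal ε * shEnt u + ENNReal.ofReal (gFun ε) := hmain
        _ ≤ shEnt q + ENNReal.ofReal ε * ENNReal.ofReal (FE E ((t - T) / ε)) +
            ENNReal.ofReal (gFun ε) := by gcongr
        _ = _ := by ring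
    refine EReal.sub_le_of_le_add ?_
    have h := EReal.coe_ennreal_le_coe_ennreal_iff.2 hfin
    rwa [EReal.coe_ennreal_add, EReal.coe_ennreal_ofReal,
      max_eq_left (add_nonneg hF0 hg)] at h
  · have : FE E ((t - T) / ε) ≤ FE E (t / ε) :=
      FE_mono hE0 hEnn hGibbs (div_le_div_of_nonneg_right (by linarith) hε0.le)
    gcongr
end

section
/- Let n ≥ 2 and let p be a probability distribution on ℕ with at most n nonzero entries. Then for every probability distribution q on ℕ and every ε with TV(p,q) ≤ ε ≤ 1 − 1/n one has H(p) − H(q) ≤ ε·ln(n−1) + h₂(ε), where H(q) is taken in [0,+∞] and the inequality is read in the extended reals. No constraint is imposed on q other than TV(p,q) ≤ ε. -/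
open scoped ENNReal

/-- **Gibbs' inequality** against a positive subprobability weight `m`. -/
lemma sum_negMulLog_le_of_sum_le {ι : Type*} (S : Finset ι) {p m : ι → ℝ}
    (hp : ∀ i ∈ S, 0 ≤ p i) (hm : ∀ i ∈ S, 0 < m i) (h : ∑ i ∈ S, m i ≤ ∑ i ∈ S, p i) :
    ∑ i ∈ S, Real.negMulLog (p i) ≤ ∑ i ∈ S, p i * -Real.log (m i) := by
  have key : ∀ i ∈ S, Real.negMulLog (p i) ≤ p i * -Real.log (m i) + (m i - p i) := by
    intro i hi
    rcases (hp i hi).eq_or_lt with h0 | h0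
    · simp [← h0, (hm i hi).le]
    · have h1 := Real.log_le_sub_one_of_pos (div_pos (hm i hi) h0)
      rw [Real.log_div (hm i hi).ne' h0.ne'] at h1
      have h2 := mul_le_mul_of_nonneg_left h1 h0.le
      have h3 : p i * (m i / p i - 1) = m i - p i := by field_simp
      rw [Real.negMulLog]
      linarith
  have := Finset.sum_le_sum key
  rw [Finset.sum_add_distrib, Finset.sum_sub_distrib] at this
  linarith

/-- If a diagonal cost is at most `A` and an off-diagonal cost at most `B`, the maximal coupling of
`p` and `q` bounds the sum of the two potentials. -/
lemma sum_potentials_le {ι : Type*} (S : Finset ι) {p q u v : ι → ℝ} {A B ε : ℝ}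
    (hp : ∀ i ∈ S, 0 ≤ p i) (hq : ∀ i ∈ S, 0 ≤ q i)
    (hps : ∑ i ∈ S, p i = 1) (hqs : ∑ i ∈ S, q i = 1)
    (hTV : ∑ i ∈ S, |p i - q i| ≤ 2 * ε) (hAB : A ≤ B)
    (hdiag : ∀ i ∈ S, 0 < q i → v i + u i ≤ A)
    (hoff : ∀ i ∈ S, ∀ j ∈ S, i ≠ j → 0 < q j → v i + u j ≤ B) :
    ∑ i ∈ S, p i * v i + ∑ i ∈ S, q i * u i ≤ (1 - ε) * A + ε * B := by
  set M : ι → ℝ := fun i => min (p i) (q i) with hM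
  set x : ι → ℝ := fun i => p i - M i with hx
  set y : ι → ℝ := fun i => q i - M i with hy
  set d : ℝ := ∑ i ∈ S, x i with hd
  have hx0 : ∀ i, 0 ≤ x i := fun i => sub_nonneg.2 (min_le_left _ _)
  have hy0 : ∀ i, 0 ≤ y i := fun i => sub_nonneg.2 (min_le_right _ _)
  have hM0 : ∀ i ∈ S, 0 ≤ M i := fun i hi => le_min (hp i hi) (hq i hi)
  have hd0 : 0 ≤ d := Finset.sum_nonneg fun i _ => hx0 i
  have hMs : ∑ i ∈ S, M i = 1 - d := by
    rw [hd, Finset.sum_sub_distrib, hps]; ring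
  have hyd : ∑ i ∈ S, y i = d := by
    rw [Finset.sum_sub_distrib, hMs, hqs]; ring
  have hdε : d ≤ ε := by
    have h1 : ∑ i ∈ S, |p i - q i| = ∑ i ∈ S, (x i + y i) := by
      refine Finset.sum_congr rfl fun i _ => ?_
      simp only [hx, hy, hM]
      rcases le_total (p i) (q i) with h | h
      · rw [min_eq_left h, abs_of_nonpos (by linarith)]; ring
      · rw [min_eq_right h, abs_of_nonneg (by linarith)]; ring
    rw [h1, Finset.sum_add_distrib, hyd] at hTV
    linarith
  have hMsum : ∑ i ∈ S, M i * (v i + u i) ≤ (1 - d) * A := by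
    rw [← hMs, Finset.sum_mul]
    refine Finset.sum_le_sum fun i hi => ?_
    rcases (hq i hi).eq_or_lt with h0 | h0
    · have : M i = 0 := le_antisymm (h0 ▸ min_le_right _ _) (hM0 i hi)
      simp [this]
    · exact mul_le_mul_of_nonneg_left (hdiag i hi h0) (hM0 i hi)
  have hprod : d * (∑ i ∈ S, x i * v i + ∑ j ∈ S, y j * u j) ≤ d * (d * B) := by
    have h1 : d * (∑ i ∈ S, x i * v i + ∑ j ∈ S, y j * u j)
        = ∑ i ∈ S, ∑ j ∈ S, x i * y j * (v i + u j) := by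
      have e1 : ∑ i ∈ S, ∑ j ∈ S, x i * y j * (v i + u j)
          = (∑ i ∈ S, x i * v i) * ∑ j ∈ S, y j + (∑ i ∈ S, x i) * ∑ j ∈ S, y j * u j := by
        rw [Finset.sum_mul_sum, Finset.sum_mul_sum, ← Finset.sum_add_distrib]
        refine Finset.sum_congr rfl fun i _ => ?_
        rw [← Finset.sum_add_distrib]
        exact Finset.sum_congr rfl fun j _ => by ring
      rw [e1, hyd, ← hd]; ring
    have h2 : d * (d * B) = ∑ i ∈ S, ∑ j ∈ S, x i * y j * B := by
      simp_rw [← Finset.sum_mul]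
      rw [← Finset.sum_mul_sum, hyd, ← hd]; ring
    rw [h1, h2]
    refine Finset.sum_le_sum fun i hi => Finset.sum_le_sum fun j hj => ?_
    by_cases hij : i = j
    · subst hij
      have : x i * y i = 0 := by
        simp only [hx, hy, hM]
        rcases le_total (p i) (q i) with h | h
        · simp [min_eq_left h]
        · simp [min_eq_right h]
      simp [this]
    rcases (hq j hj).eq_or_lt with h0 | h0
    · have : y j = 0 := by simp [hy, hM, ← h0, hp j hj]
      simp [this]
    · exact mul_le_mul_of_nonneg_left (hoff i hi j hj hij h0) (mul_nonneg (hx0 i) (hy0 j))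
  have hxy : ∑ i ∈ S, x i * v i + ∑ j ∈ S, y j * u j ≤ d * B := by
    rcases hd0.eq_or_lt with h0 | h0
    · have hxz := (Finset.sum_eq_zero_iff_of_nonneg fun i _ => hx0 i).1 (hd.symm.trans h0.symm)
      have hyz := (Finset.sum_eq_zero_iff_of_nonneg fun i _ => hy0 i).1 (hyd.trans h0.symm)
      rw [Finset.sum_eq_zero fun i hi => by rw [hxz i hi, zero_mul],
        Finset.sum_eq_zero fun i hi => by rw [hyz i hi, zero_mul], ← h0]
      simp
    · exact le_of_mul_le_mul_left hprod h0
  have hsplit : ∑ i ∈ S, p i * v i + ∑ i ∈ S, q i * u i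
      = ∑ i ∈ S, M i * (v i + u i) + (∑ i ∈ S, x i * v i + ∑ j ∈ S, y j * u j) := by
    simp_rw [← Finset.sum_add_distrib]
    exact Finset.sum_congr rfl fun i _ => by simp only [hx, hy]; ring
  rw [hsplit]
  nlinarith [mul_nonneg (sub_nonneg.2 hdε) (sub_nonneg.2 hAB)]

/-- **Audenaert's bound** for finitely supported distributions. -/
lemma sum_negMulLog_le_of_sum_abs_sub_le {ι : Type*} (S : Finset ι) {n : ℕ} (hn : 2 ≤ n)
    (hS : S.card ≤ n) {p q : ι → ℝ} (hp : ∀ i ∈ S, 0 ≤ p i) (hq : ∀ i ∈ S, 0 ≤ q i)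
    (hps : ∑ i ∈ S, p i = 1) (hqs : ∑ i ∈ S, q i = 1) {ε : ℝ} (hε0 : 0 < ε)
    (hε : ε ≤ 1 - 1 / (n : ℝ)) (hTV : ∑ i ∈ S, |p i - q i| ≤ 2 * ε) :
    ∑ i ∈ S, Real.negMulLog (p i) ≤
      (ε * Real.log ((n : ℝ) - 1) + h2 ε) + ∑ i ∈ S, Real.negMulLog (q i) := by
  have hn' : (2 : ℝ) ≤ n := by exact_mod_cast hn
  have hn1 : (0 : ℝ) < n - 1 := by linarith
  have hninv : (0 : ℝ) < 1 / n := by positivity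
  set a : ℝ := 1 - ε with ha
  set b : ℝ := ε / (n - 1) with hb
  have ha0 : 0 < a := by linarith
  have hb0 : 0 < b := by positivity
  have hbn : b * (n - 1) = ε := by rw [hb]; field_simp
  have hba : b ≤ a := by
    rw [hb, div_le_iff₀ hn1, ha]
    have : ε * n ≤ n - 1 := by
      have h := mul_le_mul_of_nonneg_right hε (by linarith : (0 : ℝ) ≤ n)
      have e : (1 - 1 / (n : ℝ)) * n = n - 1 := by field_simp
      linarith
    linarith
  set m : ι → ℝ := fun i => a * q i + b * (1 - q i) with hm
  have hq1 : ∀ i ∈ S, q i ≤ 1 := fun i hi => hqs ▸ Finset.single_le_sum hq hi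
  have hqq : ∀ i ∈ S, ∀ j ∈ S, i ≠ j → q j ≤ 1 - q i := by
    classical
    intro i hi j hj hij
    rw [← hqs, ← Finset.add_sum_erase S q hi, add_sub_cancel_left]
    exact Finset.single_le_sum (fun k hk => hq k (Finset.mem_of_mem_erase hk))
      (Finset.mem_erase.2 ⟨hij.symm, hj⟩)
  have hm0 : ∀ i ∈ S, 0 < m i := by
    intro i hi
    have := mul_le_mul_of_nonneg_right hba (hq i hi)
    simp only [hm]
    linarith
  have hms : ∑ i ∈ S, m i ≤ ∑ i ∈ S, p i := by
    have hS' : (S.card : ℝ) ≤ n := by exact_mod_cast hS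
    simp only [hm]
    rw [Finset.sum_add_distrib, ← Finset.mul_sum, ← Finset.mul_sum, Finset.sum_sub_distrib, hqs,
      hps, Finset.sum_const, nsmul_eq_mul]
    have := mul_le_mul_of_nonneg_left (sub_le_sub_right hS' 1) hb0.le
    linarith
  have hpot := sum_potentials_le S (u := fun i => Real.log (q i)) (v := fun i => -Real.log (m i))
    (A := -Real.log a) (B := -Real.log b) hp hq hps hqs hTV
    (neg_le_neg (Real.log_le_log hb0 hba))
    (by
      intro i hi h0
      have h : a * q i ≤ m i :=
        le_add_of_nonneg_right (mul_nonneg hb0.le (sub_nonneg.2 (hq1 i hi)))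
      have h := Real.log_le_log (mul_pos ha0 h0) h
      rw [Real.log_mul ha0.ne' h0.ne'] at h
      linarith)
    (by
      intro i hi j hj hij h0
      have h : b * q j ≤ m i :=
        (mul_le_mul_of_nonneg_left (hqq i hi j hj hij) hb0.le).trans
          (le_add_of_nonneg_left (mul_nonneg ha0.le (hq i hi)))
      have h := Real.log_le_log (mul_pos hb0 h0) h
      rw [Real.log_mul hb0.ne' h0.ne'] at h
      linarith)
  have hG := sum_negMulLog_le_of_sum_le S hp hm0 hms
  have hqe : ∑ i ∈ S, Real.negMulLog (q i) = -∑ i ∈ S, q i * Real.log (q i) := by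
    simp [Real.negMulLog]
  have hlogb : Real.log b = Real.log ε - Real.log ((n : ℝ) - 1) :=
    Real.log_div hε0.ne' hn1.ne'
  rw [hlogb] at hpot
  rw [hqe, h2, Real.negMulLog, Real.negMulLog, ← ha]
  linarith

/-- Merging atoms into one does not increase the entropy. -/
lemma ofReal_negMulLog_tsum_le {ι : Type*} {q : ι → ℝ} (hq : ∀ i, 0 ≤ q i) (hs : Summable q) :
    ENNReal.ofReal (Real.negMulLog (∑' i, q i)) ≤
      ∑' i, ENNReal.ofReal (Real.negMulLog (q i)) := by
  have hT0 : 0 ≤ ∑' i, q i := tsum_nonneg hq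
  rw [Real.negMulLog, neg_mul_comm, ENNReal.ofReal_mul hT0,
    ENNReal.ofReal_tsum_of_nonneg hq hs, ← ENNReal.tsum_mul_right]
  refine ENNReal.tsum_le_tsum fun i => ?_
  rw [← ENNReal.ofReal_mul (hq i), Real.negMulLog, neg_mul_comm]
  refine ENNReal.ofReal_le_ofReal ?_
  rcases (hq i).eq_or_lt with h0 | h0
  · simp [← h0]
  · exact mul_le_mul_of_nonneg_left
      (neg_le_neg (Real.log_le_log h0 (hs.le_tsum i fun j _ => hq j))) h0.le

/-- A distribution can be coarse-grained onto a finite set carrying `p`, without increasing its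
entropy or its distance to `p`. -/
lemma exists_binning {p q : ℕ → ℝ} (hp : IsProbDist p) (hq : IsProbDist q) (S : Finset ℕ)
    (hS : ∀ i, i ∉ S → p i = 0) :
    ∃ r : ℕ → ℝ, (∀ i, 0 ≤ r i) ∧ ∑ i ∈ S, r i = 1 ∧
      ∑ i ∈ S, |p i - r i| ≤ ∑' i, |p i - q i| ∧
      ENNReal.ofReal (∑ i ∈ S, Real.negMulLog (r i)) ≤ shEnt q := by
  obtain ⟨s, hs⟩ : S.Nonempty := by
    by_contra h
    rw [Finset.not_nonempty_iff_eq_empty] at h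
    have : p = 0 := funext fun i => hS i (by simp [h])
    have h1 := hp.2.tsum_eq
    simp [this] at h1
  set E := S.erase s with hE
  set T : ℝ := ∑' i : ↥((E : Set ℕ)ᶜ), q i with hT
  have hsE : ∀ i ∈ E, Function.update q s T i = q i := fun i hi =>
    Function.update_of_ne (Finset.ne_of_mem_erase hi) _ _
  have hqT : ∑ i ∈ E, q i + T = 1 := (hq.2.summable.sum_add_tsum_compl).trans hq.2.tsum_eq
  have hT0 : 0 ≤ T := tsum_nonneg fun i => hq.1 i
  have hr0 : ∀ i, 0 ≤ Function.update q s T i := by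
    intro i
    by_cases h : i = s
    · simpa [h] using hT0
    · simpa [h] using hq.1 i
  have hr1 : ∑ i ∈ S, Function.update q s T i = 1 := by
    rw [← Finset.add_sum_erase S _ hs, Function.update_self, Finset.sum_congr rfl hsE]
    linarith
  refine ⟨Function.update q s T, hr0, hr1, ?_, ?_⟩
  · have hpq : Summable fun i => p i - q i := hp.2.summable.sub hq.2.summable
    rw [← hpq.abs.sum_add_tsum_compl (s := E), ← Finset.add_sum_erase S _ hs,
      Function.update_self, add_comm]
    refine add_le_add (Finset.sum_le_sum fun i hi => by rw [hsE i hi]) ?_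
    have hpT : p s = ∑' i : ↥((E : Set ℕ)ᶜ), p i := by
      have h1 := (hp.2.summable.sum_add_tsum_compl (s := E)).trans hp.2.tsum_eq
      have h2 : ∑ i ∈ S, p i = 1 := (hasSum_sum_of_ne_finset_zero hS).unique hp.2
      rw [← Finset.add_sum_erase S _ hs] at h2
      linarith
    have hsub : ∑' i : ↥((E : Set ℕ)ᶜ), (p i - q i) = ∑' i : ↥((E : Set ℕ)ᶜ), p i - T :=
      (hp.2.summable.subtype _).tsum_sub (hq.2.summable.subtype _)
    rw [hpT, ← hsub]
    have := norm_tsum_le_tsum_norm (f := fun i : ↥((E : Set ℕ)ᶜ) => p i - q i)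
      (hpq.norm.subtype _)
    simpa only [Real.norm_eq_abs] using this
  · have hle1 : ∀ i ∈ S, Function.update q s T i ≤ 1 := fun i hi =>
      hr1 ▸ Finset.single_le_sum (fun j _ => hr0 j) hi
    rw [ENNReal.ofReal_sum_of_nonneg fun i hi => Real.negMulLog_nonneg (hr0 i) (hle1 i hi),
      ← Finset.add_sum_erase S _ hs, Function.update_self, shEnt,
      ← ENNReal.summable.tsum_add_tsum_compl (s := (E : Set ℕ)) ENNReal.summable,
      add_comm]
    refine add_le_add ?_ ?_
    · rw [Finset.sum_congr rfl fun i hi => by rw [hsE i hi]]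
      exact (Finset.tsum_subtype E fun i => ENNReal.ofReal (Real.negMulLog (q i))).ge
    exact ofReal_negMulLog_tsum_le (fun i => hq.1 i) (hq.2.summable.subtype _)

/-- **One-sided sharpened continuity bound for the Shannon entropy under a rank
constraint on the first distribution only** (classical form, via Audenaert's
bound and coarse-graining): if `p` has at most `n ≥ 2` nonzero entries then for
any probability distribution `q` with `TV(p,q) ≤ ε ≤ 1 − 1/n`,
`H(p) − H(q) ≤ ε·ln(n−1) + h₂(ε)` in the extended reals. -/
theorem entropy_rank_one_side_sharp_bound
    (n : ℕ) (hn : 2 ≤ n)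
    (p : ℕ → ℝ) (hp : IsProbDist p)
    (hsupp : (Function.support p).encard ≤ n)
    (q : ℕ → ℝ) (hq : IsProbDist q)
    (ε : ℝ) (hTV : TVd p q ≤ ε) (hε : ε ≤ 1 - 1 / (n : ℝ)) :
    (shEnt p : EReal) - (shEnt q : EReal) ≤
      ((ε * Real.log ((n : ℝ) - 1) + h2 ε : ℝ) : EReal) := by
  have hTV0 : 0 ≤ ∑' i, |p i - q i| := tsum_nonneg fun i => abs_nonneg _
  have hTV' : ∑' i, |p i - q i| ≤ 2 * ε := by
    rw [TVd] at hTV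
    linarith
  rcases (show 0 ≤ ε by linarith).eq_or_lt with h0 | hε0
  · have hpq : p = q := by
      have hs : Summable fun i => |p i - q i| := (hp.2.summable.sub hq.2.summable).abs
      have hz : ∑' i, |p i - q i| = 0 := by linarith
      have := (hs.hasSum_iff.2 hz)
      rw [hasSum_zero_iff_of_nonneg fun i => abs_nonneg _] at this
      funext i
      exact sub_eq_zero.1 (abs_eq_zero.1 (congrFun this i))
    subst hpq
    simpa [← h0, h2] using EReal.sub_self_le_zero
  have hfin : (Function.support p).Finite := Set.finite_of_encard_le_coe hsupp
  set S := hfin.toFinset with hSdef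
  have hS : ∀ i, i ∉ S → p i = 0 := fun i hi => by simpa [hSdef] using hi
  have hcard : S.card ≤ n := by
    rw [hfin.encard_eq_coe_toFinset_card] at hsupp
    exact_mod_cast hsupp
  have hps : ∑ i ∈ S, p i = 1 := (hasSum_sum_of_ne_finset_zero hS).unique hp.2
  obtain ⟨r, hr0, hr1, hrTV, hrH⟩ := exists_binning hp hq S hS
  have hmain := sum_negMulLog_le_of_sum_abs_sub_le S hn hcard (fun i _ => hp.1 i)
    (fun i _ => hr0 i) hps hr1 hε0 hε (hrTV.trans hTV')
  have hpn : ∀ i ∈ S, 0 ≤ Real.negMulLog (p i) := fun i hi =>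
    Real.negMulLog_nonneg (hp.1 i) (hps ▸ Finset.single_le_sum (fun j _ => hp.1 j) hi)
  have hpH : shEnt p = ENNReal.ofReal (∑ i ∈ S, Real.negMulLog (p i)) := by
    rw [shEnt, tsum_eq_sum (s := S) fun i hi => by simp [hS i hi],
      ENNReal.ofReal_sum_of_nonneg hpn]
  refine EReal.sub_le_of_le_add ?_
  calc (shEnt p : EReal) = ((∑ i ∈ S, Real.negMulLog (p i) : ℝ) : EReal) := by
        rw [hpH, EReal.coe_ennreal_ofReal, max_eq_left (Finset.sum_nonneg hpn)]
    _ ≤ ((ε * Real.log ((n : ℝ) - 1) + h2 ε : ℝ) : EReal) +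
          ((∑ i ∈ S, Real.negMulLog (r i) : ℝ) : EReal) := by
        exact_mod_cast hmain
    _ ≤ _ := by
        refine add_le_add le_rfl (le_trans ?_ (EReal.coe_ennreal_le_coe_ennreal_iff.2 hrH))
        rw [EReal.coe_ennreal_ofReal]
        exact_mod_cast le_max_left _ _
end

section
/- Let p be a probability distribution on ℕ×ℕ whose first marginal p₁ has at most m nonzero entries (m ≥ 1). Then for every probability distribution q on ℕ×ℕ and every ε ∈ (0,1] with TV(p,q) ≤ ε one has H(X₁|X₂)_p − H(X₁|X₂)_q ≤ ε·ln m + g(ε), where H(X₁|X₂)_q is taken in [0,+∞] and the inequality is read in the extended reals (H(X₁|X₂)_p ≤ ln m is finite). No constraint is imposed on q other than TV(p,q) ≤ ε. -/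
open scoped ENNReal

/-- First marginal `p₁(i) = ∑_j p(i,j)`. -/
noncomputable def marg1 (p : ℕ × ℕ → ℝ) (i : ℕ) : ℝ := ∑' j, p (i, j)

/-- Second marginal `p₂(j) = ∑_i p(i,j)`. -/
noncomputable def marg2 (p : ℕ × ℕ → ℝ) (j : ℕ) : ℝ := ∑' i, p (i, j)

/-- Conditional Shannon entropy
`H(X₁|X₂)_p = ∑_{j : p₂(j) > 0} p₂(j)·H(p(·|j)) ∈ [0,+∞]`
(terms with `p₂(j) = 0` contribute `0`, since `0·∞ = 0` in `ℝ≥0∞` and division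
by zero gives the zero distribution). -/
noncomputable def condEnt (p : ℕ × ℕ → ℝ) : ℝ≥0∞ :=
  ∑' j, ENNReal.ofReal (marg2 p j) * shEnt fun i => p (i, j) / marg2 p j

theorem mul_log_div_le_tangent {x s X S : ℝ} (hx : 0 ≤ x) (hs : 0 ≤ s) (hxs : x ≤ s)
    (hX : 0 < X) (hS : 0 < S) :
    x * Real.log (s / x) ≤ x * Real.log (S / X) + s * (X / S) - x := by
  rcases hx.eq_or_lt with rfl | hx
  · simp only [zero_mul, zero_add, sub_zero]
    positivity
  have hs' : 0 < s := hx.trans_le hxs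
  have h := Real.log_le_sub_one_of_pos (show 0 < s / x / (S / X) by positivity)
  rw [Real.log_div (by positivity) (by positivity)] at h
  have h2 := mul_le_mul_of_nonneg_left h hx.le
  have h3 : x * (s / x / (S / X) - 1) = s * (X / S) - x := by field_simp
  linarith

theorem mul_log_div_nonneg {x s : ℝ} (hx : 0 ≤ x) (hxs : x ≤ s) : 0 ≤ x * Real.log (s / x) := by
  rcases hx.eq_or_lt with rfl | hx
  · simp
  · exact mul_nonneg hx.le (Real.log_nonneg ((one_le_div hx).2 hxs))

theorem mul_log_div_mono {x y s t : ℝ} (hx : 0 ≤ x) (hxs : x ≤ s) (hy : 0 ≤ y) (hyt : y ≤ t) :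
    x * Real.log (s / x) ≤ (x + y) * Real.log ((s + t) / (x + y)) := by
  rcases hx.eq_or_lt with rfl | hx
  · simpa using mul_log_div_nonneg (add_nonneg le_rfl hy) (add_le_add hxs hyt)
  have hX : 0 < x + y := by linarith
  have hS : 0 < s + t := by linarith
  have h1 := mul_log_div_le_tangent hx.le (hx.le.trans hxs) hxs hX hS
  have h2 := mul_log_div_le_tangent hy (hy.trans hyt) hyt hX hS
  have h3 := mul_log_div_nonneg hy hyt
  have h4 : s * ((x + y) / (s + t)) + t * ((x + y) / (s + t)) = x + y := by field_simp
  linarith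

theorem mul_log_div_add_mul_log_div {x s u : ℝ} (hx : 0 ≤ x) (hxs : x ≤ s) (hsu : s ≤ u) :
    x * Real.log (s / x) + x * Real.log (u / s) = x * Real.log (u / x) := by
  rcases hx.eq_or_lt with rfl | hx
  · simp
  have hs : 0 < s := hx.trans_le hxs
  have hu : 0 < u := hs.trans_le hsu
  rw [Real.log_div hs.ne' hx.ne', Real.log_div hu.ne' hs.ne', Real.log_div hu.ne' hx.ne']
  ring

theorem mul_log_div_add_le {x y s t : ℝ} (hx : 0 ≤ x) (hxs : x ≤ s) (hy : 0 ≤ y) (hyt : y ≤ t) :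
    (x + y) * Real.log ((s + t) / (x + y)) ≤
      x * Real.log (s / x) + y * Real.log (t / y) +
        (x * Real.log ((s + t) / s) + y * Real.log ((s + t) / t)) := by
  have h1 := mul_log_div_add_mul_log_div hx hxs (show s ≤ s + t by linarith)
  have h2 := mul_log_div_add_mul_log_div hy hyt (show t ≤ s + t by linarith)
  have key : ∀ {a b : ℝ}, 0 ≤ a → 0 ≤ b → a ≤ s + t →
      a * Real.log ((s + t) / (a + b)) ≤ a * Real.log ((s + t) / a) := by
    intro a b ha hb has
    rcases ha.eq_or_lt with rfl | ha
    · simp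
    have : 0 < s + t := ha.trans_le has
    gcongr
    linarith
  have h3 := key hx hy (by linarith)
  have h4 := key hy hx (by linarith)
  rw [add_comm y x] at h4
  linarith

/-- The log-sum inequality for countable sums. -/
theorem tsum_ofReal_mul_log_div_le {ι : Type*} {s u : ι → ℝ} {S U : ℝ} (hs : ∀ i, 0 ≤ s i)
    (hsu : ∀ i, s i ≤ u i) (hS : HasSum s S) (hU : HasSum u U) :
    ∑' i, ENNReal.ofReal (s i * Real.log (u i / s i)) ≤ ENNReal.ofReal (S * Real.log (U / S)) := by
  rcases (hS.nonneg hs).eq_or_lt with rfl | hS0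
  · have := (hasSum_zero_iff_of_nonneg hs).1 hS
    simp [this]
  have hU0 : 0 < U := hS0.trans_le (hasSum_le hsu hS hU)
  have hT : HasSum (fun i => s i * Real.log (U / S) + u i * (S / U) - s i)
      (S * Real.log (U / S)) := by
    have h := ((hS.mul_right (Real.log (U / S))).add (hU.mul_right (S / U))).sub hS
    rwa [mul_div_cancel₀ S hU0.ne', add_sub_cancel_right] at h
  have hle i := mul_log_div_le_tangent (hs i) ((hs i).trans (hsu i)) (hsu i) hS0 hU0
  rw [← hT.tsum_eq, ENNReal.ofReal_tsum_of_nonneg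
    (fun i => (mul_log_div_nonneg (hs i) (hsu i)).trans (hle i)) hT.summable]
  exact ENNReal.tsum_le_tsum fun i => ENNReal.ofReal_le_ofReal (hle i)

section Marginals

variable {p : ℕ × ℕ → ℝ}

theorem hasSum_column (hp : Summable p) (j : ℕ) : HasSum (fun i => p (i, j)) (marg2 p j) :=
  (hp.comp_injective (Prod.mk_left_injective j)).hasSum

theorem hasSum_marg2 {S : ℝ} (hS : HasSum p S) : HasSum (marg2 p) S :=
  ((Equiv.prodComm ℕ ℕ).hasSum_iff.2 hS).prod_fiberwise fun j => hasSum_column hS.summable j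

theorem marg2_nonneg (hp : ∀ x, 0 ≤ p x) (j : ℕ) : 0 ≤ marg2 p j := tsum_nonneg fun _ => hp _

theorem le_marg2 (hp : ∀ x, 0 ≤ p x) (hs : Summable p) (i j : ℕ) : p (i, j) ≤ marg2 p j :=
  le_hasSum (hasSum_column hs j) i fun _ _ => hp _

theorem marg2_add {q : ℕ × ℕ → ℝ} (hp : Summable p) (hq : Summable q) (j : ℕ) :
    marg2 (p + q) j = marg2 p j + marg2 q j :=
  ((hasSum_column hp j).add (hasSum_column hq j)).tsum_eq

end Marginals

theorem condEnt_eq_tsum {p : ℕ × ℕ → ℝ} (hp : ∀ x, 0 ≤ p x) :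
    condEnt p = ∑' j, ∑' i, ENNReal.ofReal (p (i, j) * Real.log (marg2 p j / p (i, j))) := by
  unfold condEnt shEnt
  refine tsum_congr fun j => ?_
  rw [← ENNReal.tsum_mul_left]
  refine tsum_congr fun i => ?_
  rw [← ENNReal.ofReal_mul (marg2_nonneg hp j)]
  congr 1
  by_cases hs : marg2 p j = 0
  · simp [hs]
  · rw [Real.negMulLog, ← inv_div (p (i, j)), Real.log_inv]
    field_simp

theorem condEnt_le_condEnt_add {p b : ℕ × ℕ → ℝ} (hp : ∀ x, 0 ≤ p x) (hps : Summable p)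
    (hb : ∀ x, 0 ≤ b x) (hbs : Summable b) : condEnt p ≤ condEnt (p + b) := by
  rw [condEnt_eq_tsum hp, condEnt_eq_tsum (p := p + b) fun x => add_nonneg (hp x) (hb x)]
  refine ENNReal.tsum_le_tsum fun j => ENNReal.tsum_le_tsum fun i => ENNReal.ofReal_le_ofReal ?_
  rw [marg2_add hps hbs]
  exact mul_log_div_mono (hp _) (le_marg2 hp hps i j) (hb _) (le_marg2 hb hbs i j)

/-- Summing `x ↦ x * c j` over a table, with `c j ≥ 0` depending on the column only. -/
theorem tsum_tsum_ofReal_mul {p : ℕ × ℕ → ℝ} (hp : ∀ x, 0 ≤ p x) (hps : Summable p)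
    (c : ℕ → ℝ) :
    ∑' j, ∑' i, ENNReal.ofReal (p (i, j) * c j) = ∑' j, ENNReal.ofReal (marg2 p j * c j) := by
  refine tsum_congr fun j => ?_
  simp_rw [ENNReal.ofReal_mul (hp _), ENNReal.ofReal_mul (marg2_nonneg hp j)]
  rw [ENNReal.tsum_mul_right, marg2,
    ENNReal.ofReal_tsum_of_nonneg (fun _ => hp _) (hasSum_column hps j).summable]

theorem condEnt_add_le {q a : ℕ × ℕ → ℝ} {Q A : ℝ} (hq : ∀ x, 0 ≤ q x) (hQ : HasSum q Q)
    (ha : ∀ x, 0 ≤ a x) (hA : HasSum a A) :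
    condEnt (q + a) ≤ condEnt q + condEnt a +
      (ENNReal.ofReal (Q * Real.log ((Q + A) / Q)) +
        ENNReal.ofReal (A * Real.log ((Q + A) / A))) := by
  have hq2 := marg2_nonneg hq
  have ha2 := marg2_nonneg ha
  have hsum := (hasSum_marg2 hQ).add (hasSum_marg2 hA)
  have h1 := tsum_ofReal_mul_log_div_le hq2 (fun j => le_add_of_nonneg_right (ha2 j))
    (hasSum_marg2 hQ) hsum
  have h2 := tsum_ofReal_mul_log_div_le ha2 (fun j => le_add_of_nonneg_left (hq2 j))
    (hasSum_marg2 hA) hsum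
  rw [← tsum_tsum_ofReal_mul hq hQ.summable] at h1
  rw [← tsum_tsum_ofReal_mul ha hA.summable] at h2
  refine le_trans ?_ (add_le_add_right (add_le_add h1 h2) _)
  rw [condEnt_eq_tsum hq, condEnt_eq_tsum ha,
    condEnt_eq_tsum (p := q + a) fun x => add_nonneg (hq x) (ha x)]
  simp_rw [← ENNReal.tsum_add]
  refine ENNReal.tsum_le_tsum fun j => ENNReal.tsum_le_tsum fun i => ?_
  refine (ENNReal.ofReal_le_ofReal ?_).trans (ENNReal.ofReal_add_le.trans
    (add_le_add ENNReal.ofReal_add_le ENNReal.ofReal_add_le))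
  rw [marg2_add hQ.summable hA.summable]
  exact mul_log_div_add_le (hq _) (le_marg2 hq hQ.summable i j) (ha _)
    (le_marg2 ha hA.summable i j)

theorem condEnt_le_of_rows {a : ℕ × ℕ → ℝ} {A : ℝ} (ha : ∀ x, 0 ≤ a x) (hA : HasSum a A)
    {m : ℕ} (T : Finset ℕ) (hT : T.card ≤ m) (h0 : ∀ i ∉ T, ∀ j, a (i, j) = 0) :
    condEnt a ≤ ENNReal.ofReal (A * Real.log m) := by
  have hA0 : 0 ≤ A := hA.nonneg ha
  have hinj : Function.Injective (fun x : T × ℕ => ((x.1 : ℕ), x.2)) := by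
    rintro ⟨i, j⟩ ⟨i', j'⟩ h
    simp only [Prod.mk.injEq] at h
    exact Prod.ext (Subtype.ext h.1) h.2
  have hS : HasSum (fun x : T × ℕ => a (x.1, x.2)) A := by
    refine (hinj.hasSum_iff (f := a) ?_).2 hA
    rintro ⟨i, j⟩ hx
    exact h0 i (fun hi => hx ⟨(⟨i, hi⟩, j), rfl⟩) j
  have hm := hasSum_marg2 hA
  have hU : HasSum (fun x : T × ℕ => marg2 a x.2) (T.card * A) := by
    have h1 := hasSum_fintype fun _ : T => (1 : ℝ)
    simpa using h1.mul hm (h1.summable.mul_of_nonneg hm.summable (fun _ => zero_le_one)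
      (marg2_nonneg ha))
  have hrow_le (x : T × ℕ) : a (x.1, x.2) ≤ marg2 a x.2 := le_marg2 ha hA.summable x.1 x.2
  have key := tsum_ofReal_mul_log_div_le (fun x : T × ℕ => ha (x.1, x.2)) hrow_le hS hU
  have hrows : ∑' x : T × ℕ, ENNReal.ofReal (a (x.1, x.2) * Real.log (marg2 a x.2 / a (x.1, x.2))) =
      condEnt a := by
    rw [condEnt_eq_tsum ha, ENNReal.tsum_comm, ENNReal.tsum_prod (f := fun (i : T) j =>
      ENNReal.ofReal (a (i, j) * Real.log (marg2 a j / a (i, j))))]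
    refine Subtype.val_injective.tsum_eq (f := fun i =>
      ∑' j, ENNReal.ofReal (a (i, j) * Real.log (marg2 a j / a (i, j)))) fun i hi => ?_
    by_contra hiT
    have hiT' : i ∉ T := fun h => hiT ⟨⟨i, h⟩, rfl⟩
    exact hi (by simp [h0 i hiT'])
  rw [← hrows]
  refine key.trans (ENNReal.ofReal_le_ofReal ?_)
  rcases hA0.eq_or_lt with h | hA0
  · simp [← h]
  have hle : A ≤ T.card * A := hasSum_le hrow_le hS hU
  have hpos : (0 : ℝ) < T.card := pos_of_mul_pos_left (hA0.trans_le hle) hA0.le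
  have hcm : (T.card : ℝ) ≤ m := Nat.cast_le.2 hT
  rw [mul_div_cancel_right₀ _ hA0.ne']
  exact mul_le_mul_of_nonneg_left (Real.log_le_log hpos hcm) hA0.le

theorem gFun_eq {x : ℝ} (hx : 0 ≤ x) :
    gFun x = 1 * Real.log ((1 + x) / 1) + x * Real.log ((1 + x) / x) := by
  rcases hx.eq_or_lt with rfl | hx
  · simp [gFun]
  rw [Real.log_div (by positivity) hx.ne', gFun, add_comm x 1]
  simp only [div_one]
  ring

theorem gFun_mono {x y : ℝ} (hx : 0 ≤ x) (hxy : x ≤ y) : gFun x ≤ gFun y := by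
  rw [gFun_eq hx, gFun_eq (hx.trans hxy)]
  have h1 := mul_log_div_mono hx (show x ≤ 1 + x by linarith) (sub_nonneg.2 hxy) le_rfl
  rw [add_assoc 1 x, add_sub_cancel] at h1
  gcongr

/-- **One-sided continuity bound for the conditional Shannon entropy under a
rank constraint on the first marginal of the first distribution only**: if `p₁`
has at most `m ≥ 1` nonzero entries, then `H(X₁|X₂)_p ≤ ln m` and for any
probability distribution `q` on `ℕ×ℕ` with `TV(p,q) ≤ ε ≤ 1`,
`H(X₁|X₂)_p − H(X₁|X₂)_q ≤ ε·ln m + g(ε)` in the extended reals. -/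
theorem condEntropy_rank_one_side_bound
    (p : ℕ × ℕ → ℝ) (hp : IsProbDist p)
    (m : ℕ) (hm : 1 ≤ m)
    (hsupp : (Function.support (marg1 p)).encard ≤ m)
    (q : ℕ × ℕ → ℝ) (hq : IsProbDist q)
    (ε : ℝ) (hε0 : 0 < ε) (hε1 : ε ≤ 1) (hTV : TVd p q ≤ ε) :
    condEnt p ≤ ENNReal.ofReal (Real.log m) ∧
    (condEnt p : EReal) - (condEnt q : EReal) ≤
      ((ε * Real.log m + gFun ε : ℝ) : EReal) := by
  have hp0 := hp.1
  obtain ⟨T, hTs⟩ : ∃ T : Finset ℕ, (T : Set ℕ) = Function.support (marg1 p) :=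
    (Set.finite_of_encard_le_coe hsupp).exists_finset_coe
  have hTc : T.card ≤ m := by
    rw [← hTs, Set.encard_coe_eq_coe_finsetCard] at hsupp
    exact_mod_cast hsupp
  have hrow : ∀ i ∉ T, ∀ j, p (i, j) = 0 := by
    intro i hi j
    have h0 : marg1 p i = 0 := by
      by_contra h
      exact hi (Finset.mem_coe.1 (hTs ▸ h))
    have hs := (hp.2.summable.comp_injective (Prod.mk_right_injective i)).hasSum
    exact le_antisymm ((le_hasSum hs j fun _ _ => hp0 _).trans h0.le) (hp0 _)
  have hpm := condEnt_le_of_rows hp0 hp.2 T hTc hrow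
  rw [one_mul] at hpm
  refine ⟨hpm, ?_⟩
  have hpq := hp.2.sub hq.2
  rw [sub_self] at hpq
  have habs : HasSum (fun x => |p x - q x|) (2 * TVd p q) := by
    have h : 2 * TVd p q = ∑' x, |p x - q x| := by
      unfold TVd
      ring
    exact h ▸ hpq.summable.abs.hasSum
  set δ := TVd p q
  set a : ℕ × ℕ → ℝ := fun x => (|p x - q x| + (p x - q x)) / 2 with ha_def
  set b : ℕ × ℕ → ℝ := fun x => (|p x - q x| - (p x - q x)) / 2 with hb_def
  have ha : HasSum a δ := by
    have h := (habs.add hpq).div_const 2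
    rwa [add_zero, mul_div_cancel_left₀ _ two_ne_zero] at h
  have hb : HasSum b δ := by
    have h := (habs.sub hpq).div_const 2
    rwa [sub_zero, mul_div_cancel_left₀ _ two_ne_zero] at h
  have ha0 x : 0 ≤ a x := by
    have := neg_abs_le (p x - q x)
    simp only [ha_def]
    linarith
  have hb0 x : 0 ≤ b x := by
    have := le_abs_self (p x - q x)
    simp only [hb_def]
    linarith
  have hap x : a x ≤ p x := by
    have : |p x - q x| ≤ p x + q x :=
      abs_sub_le_iff.2 ⟨by linarith [hq.1 x], by linarith [hp0 x]⟩
    simp only [ha_def]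
    linarith
  have hδ : 0 ≤ δ := ha.nonneg ha0
  have hpb : p + b = q + a := by
    funext x
    simp only [ha_def, hb_def, Pi.add_apply]
    ring
  have h1 := condEnt_le_condEnt_add hp0 hp.2.summable hb0 hb.summable
  rw [hpb] at h1
  have h2 := h1.trans (condEnt_add_le hq.1 hq.2 ha0 ha)
  have h3 := condEnt_le_of_rows ha0 ha T hTc fun i hi j =>
    le_antisymm ((hap _).trans (hrow i hi j).le) (ha0 _)
  have hlog : 0 ≤ Real.log m := Real.log_natCast_nonneg m
  have hB : condEnt p ≤ condEnt q + ENNReal.ofReal (ε * Real.log m + gFun ε) := by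
    refine h2.trans ?_
    rw [add_assoc]
    gcongr
    rw [← ENNReal.ofReal_add
      (mul_log_div_nonneg zero_le_one (le_add_of_nonneg_right hδ))
      (mul_log_div_nonneg hδ (le_add_of_nonneg_left zero_le_one)), ← gFun_eq hδ]
    have hg : 0 ≤ gFun δ := by simpa [gFun] using gFun_mono le_rfl hδ
    refine (add_le_add_left h3 _).trans ?_
    rw [← ENNReal.ofReal_add (by positivity) hg]
    have := gFun_mono hδ hTV
    gcongr
  have hg : 0 ≤ gFun ε := by simpa [gFun] using gFun_mono le_rfl hε0.le
  refine EReal.sub_le_of_le_add' ?_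
  have h5 := EReal.coe_ennreal_le_coe_ennreal_iff.2 hB
  rwa [EReal.coe_ennreal_add, EReal.coe_ennreal_ofReal, max_eq_left (by positivity)] at h5
end
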